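/- arXiv:2106.00331 — 5 statements merged into one kernel-verified Lean document; each statement's English description precedes it below -/
import Mathlib

section
/- Let X be a real Banach space. Then X is isomorphic to a Hilbert space (there exist a real Hilbert space H and a bounded linear bijection from X onto H with bounded inverse) if and only if every convex compact subset K ⊆ X is a Lipschitz retract of X, i.e. for every convex compact K ⊆ X there exists a Lipschitz map R : X → K with R(k) = k for all k ∈ K. -/
open Metric

/-- A witness that `X` is isomorphic to a real Hilbert space: a real Hilbert space `H`
together with a continuous linear equivalence (a bounded linear bijection with bounded
inverse) from `X` onto `H`. -/
structure HilbertIso (X : Type u) [NormedAddCommGroup X] [NormedSpace ℝ X] where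
  H : Type u
  [instNormedAddCommGroup : NormedAddCommGroup H]
  [instInnerProductSpace : InnerProductSpace ℝ H]
  [instCompleteSpace : CompleteSpace H]
  equiv : X ≃L[ℝ] H

open Filter Topology Pointwise in
/-- **Markov–Kakutani** for a single continuous linear map. -/
theorem exists_fixed_point_of_mapsTo_compact_convex {V : Type*} [AddCommGroup V] [Module ℝ V]
    [TopologicalSpace V] [IsTopologicalAddGroup V] [ContinuousSMul ℝ V] [T2Space V]
    (T : V →ₗ[ℝ] V) (hT : Continuous T) {K : Set V} (hne : K.Nonempty) (hK : IsCompact K)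
    (hconv : Convex ℝ K) (hmaps : Set.MapsTo T K K) : ∃ x ∈ K, T x = x := by
  obtain ⟨x₀, hx₀⟩ := hne
  have hiter : ∀ k, (T^[k]) x₀ ∈ K := fun k => hmaps.iterate k hx₀
  set x : ℕ → V := fun n => ((n : ℝ) + 1)⁻¹ • ∑ k ∈ Finset.range (n + 1), (T^[k]) x₀ with hx
  have hxK : ∀ n, x n ∈ K := by
    intro n
    have := hconv.sum_mem (t := Finset.range (n + 1)) (w := fun _ => ((n : ℝ) + 1)⁻¹)
      (z := fun k => (T^[k]) x₀) (fun _ _ => by positivity)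
      (by simp; field_simp) (fun k _ => hiter k)
    simpa [hx, Finset.smul_sum] using this
  have hdiff : ∀ n, T (x n) - x n = ((n : ℝ) + 1)⁻¹ • ((T^[n + 1]) x₀ - x₀) := by
    intro n
    simp only [hx, map_smul, map_sum, ← smul_sub, ← Finset.sum_sub_distrib]
    congr 1
    have := Finset.sum_range_sub (fun k => (T^[k]) x₀) (n + 1)
    simpa [Function.iterate_succ_apply'] using this
  have hle : map x (Filter.hyperfilter ℕ : Filter ℕ) ≤ 𝓟 K := by
    simp only [le_principal_iff, mem_map]
    exact Filter.univ_mem' hxK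
  obtain ⟨y, hyK, hy⟩ := hK.ultrafilter_le_nhds ((Filter.hyperfilter ℕ).map x) hle
  have hy : Tendsto x (Filter.hyperfilter ℕ : Filter ℕ) (𝓝 y) := hy
  refine ⟨y, hyK, ?_⟩
  have h1 : Tendsto (fun n => T (x n) - x n) (Filter.hyperfilter ℕ : Filter ℕ) (𝓝 (T y - y)) :=
    ((hT.tendsto y).comp hy).sub hy
  have h2 : Tendsto (fun n => T (x n) - x n) (Filter.hyperfilter ℕ : Filter ℕ) (𝓝 0) := by
    simp only [hdiff]
    have hb : Bornology.IsVonNBounded ℝ (K - K) := by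
      let _ := IsTopologicalAddGroup.rightUniformSpace V
      have := isUniformAddGroup_of_addCommGroup (G := V)
      have hKK : IsCompact (K - K) := by
        convert (hK.prod hK).image (f := fun p : V × V => p.1 - p.2) (by fun_prop) using 1
        ext v
        simp [Set.mem_sub]
      exact hKK.totallyBounded.isVonNBounded ℝ
    refine hb.smul_tendsto_zero (Eventually.of_forall fun n => Set.sub_mem_sub (hiter _) hx₀) ?_
    refine Tendsto.mono_left ?_ (Nat.hyperfilter_le_atTop)
    exact tendsto_one_div_add_atTop_nhds_zero_nat.congr (by simp)
  exact sub_eq_zero.mp (tendsto_nhds_unique h1 h2)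

/-- **Markov–Kakutani** for a commuting family of continuous linear maps. -/
theorem exists_common_fixed_point_of_mapsTo_compact_convex {V ι : Type*} [AddCommGroup V]
    [Module ℝ V] [TopologicalSpace V] [IsTopologicalAddGroup V] [ContinuousSMul ℝ V] [T2Space V]
    (T : ι → V →ₗ[ℝ] V) (hT : ∀ i, Continuous (T i)) (hcomm : ∀ i j v, T i (T j v) = T j (T i v))
    {K : Set V} (hne : K.Nonempty) (hK : IsCompact K) (hconv : Convex ℝ K)
    (hmaps : ∀ i, Set.MapsTo (T i) K K) : ∃ x ∈ K, ∀ i, T i x = x := by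
  have hclosed : ∀ i, IsClosed {x | T i x = x} := fun i => isClosed_eq (hT i) continuous_id
  have hfin : ∀ s : Finset ι, (K ∩ ⋂ i ∈ s, {x | T i x = x}).Nonempty := by
    classical
    intro s
    induction s using Finset.induction_on with
    | empty => simpa using hne
    | insert a s _ ih =>
      obtain ⟨x, ⟨hxK, hxs⟩, hxa⟩ := exists_fixed_point_of_mapsTo_compact_convex (T a) (hT a) ih
        (hK.inter_right (isClosed_biInter fun i _ => hclosed i))
        (hconv.inter (convex_iInter₂ fun i _ => by
          intro x hx y hy p q _ _ _
          simp only [Set.mem_ofPred_eq, map_add, map_smul] at hx hy ⊢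
          rw [hx, hy]))
        (by
          rintro x ⟨hx, hxs⟩
          refine ⟨hmaps a hx, ?_⟩
          simp only [Set.mem_iInter, Set.mem_ofPred_eq] at hxs ⊢
          intro i hi
          rw [hcomm, hxs i hi])
      exact ⟨x, hxK, by simpa [hxa] using hxs⟩
  obtain ⟨x, hxK, hx⟩ := hK.inter_iInter_nonempty _ hclosed hfin
  exact ⟨x, hxK, by simpa using hx⟩

section LinearProjection

variable {X : Type*} [NormedAddCommGroup X] [NormedSpace ℝ X]

/-- `E` is the range of a linear projection of norm at most `c`. -/
def IsComplementedWith (E : Submodule ℝ X) (c : ℝ) : Prop :=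
  ∃ P : X →ₗ[ℝ] X, (∀ x, ‖P x‖ ≤ c * ‖x‖) ∧ (∀ x, P x ∈ E) ∧ ∀ x ∈ E, P x = x

/-- The `M`-Lipschitz maps `X → E` that fix every point of `C`. -/
def lipschitzFixing (E : Submodule ℝ X) (M : ℝ) (C : Set E) : Set (X → E) :=
  {g | (∀ x y, ‖g x - g y‖ ≤ M * ‖x - y‖) ∧ ∀ e ∈ C, g e = e}

theorem isClosed_lipschitzFixing (E : Submodule ℝ X) (M : ℝ) (C : Set E) :
    IsClosed (lipschitzFixing E M C) := by
  simp only [lipschitzFixing, Set.ofPred_and, Set.ofPred_forall]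
  refine IsClosed.inter ?_ ?_
  · exact isClosed_iInter fun x => isClosed_iInter fun y =>
      isClosed_le (by fun_prop) continuous_const
  · exact isClosed_iInter fun e => isClosed_iInter fun _ =>
      isClosed_eq (by fun_prop) continuous_const

theorem isCompact_lipschitzFixing (E : Submodule ℝ X) [FiniteDimensional ℝ E] (M : ℝ) {C : Set E}
    (hC : (0 : E) ∈ C) : IsCompact (lipschitzFixing E M C) := by
  have : ProperSpace E := FiniteDimensional.proper ℝ E
  refine (isCompact_univ_pi fun x : X =>
    isCompact_closedBall (0 : E) (M * ‖x‖)).of_isClosed_subset (isClosed_lipschitzFixing E M C) ?_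
  rintro g ⟨hg, hgC⟩ x -
  have h0 : g 0 = 0 := by simpa using hgC 0 hC
  simpa [h0] using hg x 0

theorem convex_lipschitzFixing (E : Submodule ℝ X) (M : ℝ) (C : Set E) :
    Convex ℝ (lipschitzFixing E M C) := by
  rintro g ⟨hg, hgC⟩ h ⟨hh, hhC⟩ p q hp hq hpq
  refine ⟨fun x y => ?_, fun e he => ?_⟩
  · have : (p • g + q • h) x - (p • g + q • h) y = p • (g x - g y) + q • (h x - h y) := by
      simp only [Pi.add_apply, Pi.smul_apply, smul_sub]; abel
    rw [this]
    calc _ ≤ ‖p • (g x - g y)‖ + ‖q • (h x - h y)‖ := norm_add_le _ _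
      _ = p * ‖g x - g y‖ + q * ‖h x - h y‖ := by
        rw [norm_smul, norm_smul, Real.norm_of_nonneg hp, Real.norm_of_nonneg hq]
      _ ≤ p * (M * ‖x - y‖) + q * (M * ‖x - y‖) := by gcongr; exacts [hg x y, hh x y]
      _ = M * ‖x - y‖ := by rw [← add_mul, hpq, one_mul]
  · simp [hgC e he, hhC e he, ← add_smul, hpq]

/-- The increments of `g` from the base point `y`. -/
def increment (E : Submodule ℝ X) (y : X) : (X → E) →ₗ[ℝ] (X → E) where
  toFun g x := g (x + y) - g y
  map_add' g h := by ext x; simp; abel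
  map_smul' c g := by ext x; simp [smul_sub]

theorem increment_apply (E : Submodule ℝ X) (y x : X) (g : X → E) :
    increment E y g x = g (x + y) - g y := rfl

theorem continuous_increment (E : Submodule ℝ X) (y : X) : Continuous (increment E y) :=
  continuous_pi fun x => by
    simp only [increment_apply]
    fun_prop

theorem increment_comm (E : Submodule ℝ X) (y z : X) (g : X → E) :
    increment E y (increment E z g) = increment E z (increment E y g) := by
  ext x
  simp only [increment_apply, add_comm y z, add_assoc]
  simp

/-- A Lipschitz map onto a finite-dimensional subspace that fixes a neighbourhood of zero in the
subspace can be replaced by a linear projection with the same constant. -/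
theorem isComplementedWith_of_lipschitz (E : Submodule ℝ X) [FiniteDimensional ℝ E] {M r : ℝ}
    (hr : 0 < r) (f : X → E) (hf : ∀ x y, ‖f x - f y‖ ≤ M * ‖x - y‖)
    (hfE : ∀ e : E, ‖e‖ ≤ r → f e = e) : IsComplementedWith E M := by
  -- blow up to fix all of `E`
  have hblow : ∀ n : ℕ, (lipschitzFixing E M (closedBall 0 (n : ℝ))).Nonempty := by
    intro n
    set s : ℝ := r / (n + 1)
    have hs : 0 < s := by positivity
    refine ⟨fun x => s⁻¹ • f (s • x), fun x y => ?_, fun e he => ?_⟩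
    · rw [← smul_sub, norm_smul, norm_inv, Real.norm_of_nonneg hs.le]
      have := hf (s • x) (s • y)
      rw [← smul_sub, norm_smul, Real.norm_of_nonneg hs.le] at this
      rw [inv_mul_le_iff₀ hs]
      linarith
    · have he' : ‖s • e‖ ≤ r := by
        rw [norm_smul, Real.norm_of_nonneg hs.le]
        have : ‖e‖ ≤ n := by simpa using he
        calc s * ‖e‖ ≤ s * (n + 1) := by gcongr; linarith
          _ = r := by simp only [s]; field_simp
      have := hfE (s • e) he'
      simp only [Submodule.coe_smul] at this
      simp only [this, smul_smul, inv_mul_cancel₀ hs.ne', one_smul]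
  have hne : (lipschitzFixing E M Set.univ).Nonempty := by
    obtain ⟨g, hg⟩ := IsCompact.nonempty_iInter_of_sequence_nonempty_isCompact_isClosed
      (fun n : ℕ => lipschitzFixing E M (closedBall 0 (n : ℝ)))
      (fun n g hg => ⟨hg.1, fun e he => hg.2 e (closedBall_subset_closedBall (by simp) he)⟩)
      hblow (isCompact_lipschitzFixing E M (by simp)) (fun n => isClosed_lipschitzFixing _ _ _)
    simp only [Set.mem_iInter] at hg
    refine ⟨g, (hg 0).1, fun e _ => ?_⟩
    obtain ⟨n, hn⟩ := exists_nat_ge ‖e‖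
    exact (hg n).2 e (by simpa using hn)
  have hcpt := isCompact_lipschitzFixing E M (Set.mem_univ (0 : E))
  have hlip : ∀ y, ∀ g ∈ lipschitzFixing E M Set.univ, ∀ x x',
      ‖increment E y g x - increment E y g x'‖ ≤ M * ‖x - x'‖ := by
    rintro y g ⟨hg, -⟩ x x'
    simpa [increment_apply] using hg (x + y) (x' + y)
  -- average over `E`
  obtain ⟨g, hg, hgE⟩ := exists_common_fixed_point_of_mapsTo_compact_convex
    (fun e : E => increment E (e : X)) (fun e => continuous_increment E _)
    (fun e e' => increment_comm E _ _) hne hcpt (convex_lipschitzFixing E M _)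
    (fun e g hg => ⟨hlip _ g hg, fun e' _ => by
      have h1 := hg.2 (e' + e) trivial
      have h2 := hg.2 e trivial
      simp only [Submodule.coe_add] at h1
      simp [increment_apply, h1, h2]⟩)
  -- average over `X`
  have hclosed : IsClosed {g : X → E | ∀ e : E, increment E (e : X) g = g} := by
    simp only [Set.ofPred_forall]
    exact isClosed_iInter fun e => isClosed_eq (continuous_increment E _) continuous_id
  obtain ⟨h, ⟨hh, -⟩, hhX⟩ := exists_common_fixed_point_of_mapsTo_compact_convex
    (fun y : X => increment E y) (continuous_increment E)
    (fun y y' => increment_comm E _ _)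
    (K := lipschitzFixing E M Set.univ ∩ {g | ∀ e : E, increment E (e : X) g = g})
    ⟨g, hg, hgE⟩ (hcpt.inter_right hclosed)
    ((convex_lipschitzFixing E M _).inter (by
      intro g hg h hh p q _ _ _ e
      rw [map_add, map_smul, map_smul, hg e, hh e]))
    (fun y g hg => ⟨⟨hlip y g hg.1, fun e _ => by
        have h1 := congrFun (hg.2 e) y
        have h2 := hg.1.2 e trivial
        simp only [increment_apply] at h1 ⊢
        rw [add_comm, ← h1, h2]
        abel_nf⟩,
      fun e => by rw [increment_comm, hg.2 e]⟩)
  have hadd : ∀ x y, h (x + y) = h x + h y := fun x y => by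
    have := congrFun (hhX y) x
    rw [increment_apply] at this
    rw [← this]; abel
  have hcont : Continuous h := by
    refine LipschitzWith.continuous (K := M.toNNReal) (LipschitzWith.of_dist_le_mul fun x y => ?_)
    rw [dist_eq_norm, dist_eq_norm]
    refine (hh.1 x y).trans ?_
    gcongr
    exact Real.le_coe_toNNReal M
  let hl : X →L[ℝ] E := (AddMonoidHom.mk' h hadd).toRealLinearMap hcont
  refine ⟨E.subtype ∘ₗ (hl : X →ₗ[ℝ] E), fun x => ?_, fun x => (hl x).2, fun x hx => ?_⟩
  · have h0 : h 0 = 0 := by simpa using hh.2 0 trivial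
    have := hh.1 x 0
    rwa [h0, sub_zero, sub_zero] at this
  · have := hh.2 ⟨x, hx⟩ trivial
    change ((h x : E) : X) = x
    rw [show h x = ⟨x, hx⟩ from this]

end LinearProjection

section UniformComplementation

variable {X : Type*} [NormedAddCommGroup X] [NormedSpace ℝ X]

theorem IsComplementedWith.mono {E : Submodule ℝ X} {c c' : ℝ} (h : IsComplementedWith E c)
    (hc : c ≤ c') : IsComplementedWith E c' := by
  obtain ⟨P, h1, h2⟩ := h
  exact ⟨P, fun x => (h1 x).trans (by gcongr), h2⟩

/-- The finite-dimensional subspaces of `Z` are complemented with a common constant. -/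
def UniformlyComplemented (Z : Submodule ℝ X) : Prop :=
  ∃ c : ℝ, ∀ E ≤ Z, FiniteDimensional ℝ E → IsComplementedWith E c

theorem UniformlyComplemented.of_inf_ker {Z : Submodule ℝ X} (φ : X →ₗ[ℝ] ℝ)
    (h : UniformlyComplemented (Z ⊓ LinearMap.ker φ)) : UniformlyComplemented Z := by
  obtain ⟨c, hc⟩ := h
  refine ⟨|c| + (1 + |c|), fun E hE hfin => ?_⟩
  obtain ⟨P, hPn, hPm, hPe⟩ := hc (E ⊓ LinearMap.ker φ) (inf_le_inf_right _ hE)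
    (Submodule.finiteDimensional_of_le inf_le_left)
  have hPn : ∀ x, ‖P x‖ ≤ |c| * ‖x‖ := fun x =>
    (hPn x).trans (mul_le_mul_of_nonneg_right (le_abs_self c) (norm_nonneg x))
  by_cases hker : E ≤ LinearMap.ker φ
  · rw [inf_eq_left.mpr hker] at hPm hPe
    exact IsComplementedWith.mono ⟨P, hPn, hPm, hPe⟩ (by linarith [abs_nonneg c])
  obtain ⟨u, huE, hu⟩ := Set.not_subset.mp hker
  have hu : φ u ≠ 0 := hu
  set v := u - P u with hv
  have hφP : ∀ x, φ (P x) = 0 := fun x => (hPm x).2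
  have hφv : φ v = φ u := by simp [hv, hφP]
  have hvE : v ∈ E := E.sub_mem huE (hPm u).1
  have hPv : P v = 0 := by rw [hv, map_sub, hPe _ (hPm u), sub_self]
  have hv0 : v ≠ 0 := fun h => hu (by rw [← hφv, h, map_zero])
  obtain ⟨ψ, hψ, hψv⟩ := exists_dual_vector ℝ v (norm_ne_zero_iff.mpr hv0)
  have hψv : ψ v = ‖v‖ := by simpa using hψv
  have hψn : ∀ x, |ψ x| ≤ ‖x‖ := fun x => by
    have := ψ.le_opNorm x
    rwa [hψ, one_mul] at this
  have hnv : ‖v‖ ≠ 0 := norm_ne_zero_iff.mpr hv0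
  let Q : X →ₗ[ℝ] X := ((‖v‖⁻¹ • (ψ : X →ₗ[ℝ] ℝ)).smulRight v) ∘ₗ (LinearMap.id - P)
  have hQ : ∀ x, Q x = (‖v‖⁻¹ * ψ (x - P x)) • v := fun x => rfl
  refine ⟨P + Q, fun x => ?_, fun x => ?_, fun x hx => ?_⟩
  · have h1 : ‖Q x‖ ≤ ‖x - P x‖ := by
      rw [hQ, norm_smul, norm_mul, norm_inv, norm_norm, mul_right_comm, inv_mul_cancel₀ hnv,
        one_mul]
      exact hψn _
    calc ‖(P + Q) x‖ ≤ ‖P x‖ + ‖Q x‖ := norm_add_le _ _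
      _ ≤ ‖P x‖ + (‖x‖ + ‖P x‖) := by gcongr; exact h1.trans (norm_sub_le _ _)
      _ ≤ _ := by linarith [hPn x]
  · exact E.add_mem (hPm x).1 (by rw [hQ]; exact E.smul_mem _ hvE)
  · -- `x - (φ x / φ v) • v` lies in the hyperplane
    set t := φ x / φ v
    have hw : x - t • v ∈ E ⊓ LinearMap.ker φ :=
      ⟨E.sub_mem hx (E.smul_mem _ hvE), by
        change φ (x - t • v) = 0
        simp only [map_sub, map_smul, smul_eq_mul, t]
        rw [div_mul_cancel₀ _ (by rw [hφv]; exact hu), sub_self]⟩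
    have hPx : P x = x - t • v := by
      have := hPe _ hw
      rwa [map_sub, map_smul, hPv, smul_zero, sub_zero] at this
    have hQx : Q x = t • v := by
      rw [hQ, hPx, sub_sub_cancel, map_smul, hψv, smul_eq_mul, mul_comm t, ← mul_assoc,
        inv_mul_cancel₀ hnv, one_mul]
    rw [LinearMap.add_apply, hPx, hQx, sub_add_cancel]

theorem UniformlyComplemented.of_inf_iInf_ker {Z : Submodule ℝ X} (Φ : Finset (X →ₗ[ℝ] ℝ))
    (h : UniformlyComplemented (Z ⊓ ⨅ φ ∈ Φ, LinearMap.ker φ)) : UniformlyComplemented Z := by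
  classical
  induction Φ using Finset.induction_on with
  | empty => simpa using h
  | insert φ Φ _ ih =>
    refine ih (UniformlyComplemented.of_inf_ker φ ?_)
    rwa [Finset.iInf_insert, inf_comm (LinearMap.ker φ), ← inf_assoc] at h

/-- A finite-dimensional subspace is separated from a subspace of finite codimension. -/
theorem exists_finset_norm_le_two_mul (S : Submodule ℝ X) [FiniteDimensional ℝ S] :
    ∃ Φ : Finset (X →ₗ[ℝ] ℝ), ∀ s ∈ S, ∀ z ∈ (⨅ φ ∈ Φ, LinearMap.ker φ : Submodule ℝ X),
      ‖s‖ ≤ 2 * ‖s + z‖ := by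
  classical
  have : ProperSpace S := FiniteDimensional.proper ℝ S
  obtain ⟨t, htS, hfin, hcov⟩ := (isCompact_sphere (0 : S) 1).finite_cover_balls
    (show (0 : ℝ) < 1 / 2 by norm_num)
  choose ψ hψ hψv using fun x : S => exists_dual_vector'' ℝ (x : X)
  refine ⟨hfin.toFinset.image fun x => (ψ x : X →ₗ[ℝ] ℝ), fun s hs z hz => ?_⟩
  rcases eq_or_ne s 0 with rfl | hs0
  · simp
  have hns : 0 < ‖s‖ := norm_pos_iff.mpr hs0
  let u : S := ‖s‖⁻¹ • ⟨s, hs⟩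
  have hu : (u : X) = ‖s‖⁻¹ • s := rfl
  have hu1 : ‖u‖ = 1 := by
    change ‖(u : X)‖ = 1
    rw [hu, norm_smul, norm_inv, norm_norm, inv_mul_cancel₀ hns.ne']
  obtain ⟨x, hxt, hx⟩ := Set.mem_iUnion₂.mp (hcov (mem_sphere_zero_iff_norm.mpr hu1))
  have hx1 : ‖(x : X)‖ = 1 := by simpa using htS hxt
  have hzx : ψ x z = 0 := by
    simp only [Submodule.mem_iInf] at hz
    exact hz _ (Finset.mem_image_of_mem _ (hfin.mem_toFinset.mpr hxt))
  have hle : ∀ y, ψ x y ≤ ‖y‖ := fun y => by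
    have := (ψ x).le_of_opNorm_le (hψ x) y
    rw [one_mul] at this
    exact (le_abs_self _).trans this
  have hxx : ψ x x = 1 := by rw [hψv x, hx1]; simp
  have h1 : ψ x (x - u) ≤ 1 / 2 := by
    refine (hle _).trans ?_
    rw [mem_ball, dist_eq_norm, norm_sub_rev] at hx
    exact_mod_cast hx.le
  have h2 : ψ x u = ‖s‖⁻¹ * ψ x (s + z) := by rw [hu, map_smul, map_add, hzx, add_zero, smul_eq_mul]
  have h3 : 1 / 2 ≤ ‖s‖⁻¹ * ‖s + z‖ := by
    rw [map_sub, hxx, h2] at h1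
    have : ‖s‖⁻¹ * ψ x (s + z) ≤ ‖s‖⁻¹ * ‖s + z‖ := by gcongr; exact hle _
    linarith
  rw [← div_eq_inv_mul, le_div_iff₀ hns] at h3
  linarith

/-- Partial sums of a sequence of separated subspaces are controlled by the whole sum. -/
theorem norm_coord_le_of_separated {E S Z : ℕ → Submodule ℝ X}
    (hES : ∀ n, S (n + 1) = S n ⊔ E n) (hEZ : ∀ n, E n ≤ Z n) (hZ : Antitone Z)
    (hsep : ∀ n, ∀ s ∈ S n, ∀ z ∈ Z n, ‖s‖ ≤ 2 * ‖s + z‖) {c : ℕ → X} (hc : ∀ n, c n ∈ E n)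
    {x : X} (hx : HasSum c x) (n : ℕ) : ‖c n‖ ≤ 4 * ‖x‖ := by
  have hS : ∀ n, ∑ i ∈ Finset.range n, c i ∈ S n := by
    intro n
    induction n with
    | zero => simp
    | succ n ih =>
      rw [Finset.sum_range_succ, hES]
      exact Submodule.add_mem_sup ih (hc n)
  have hpart : ∀ n, ‖∑ i ∈ Finset.range n, c i‖ ≤ 2 * ‖x‖ := by
    intro n
    refine ge_of_tendsto ((hx.tendsto_sum_nat.norm).const_mul 2) ?_
    filter_upwards [Filter.eventually_ge_atTop n] with N hN
    rw [← Finset.sum_range_add_sum_Ico _ hN]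
    exact hsep n _ (hS n) _ (Submodule.sum_mem _ fun i hi =>
      hZ (Finset.mem_Ico.mp hi).1 (hEZ i (hc i)))
  have : c n = ∑ i ∈ Finset.range (n + 1), c i - ∑ i ∈ Finset.range n, c i := by
    rw [Finset.sum_range_succ]; abel
  rw [this]
  refine (norm_sub_le _ _).trans ?_
  linarith [hpart n, hpart (n + 1)]

theorem exists_separated_sequence (h : ¬ UniformlyComplemented (⊤ : Submodule ℝ X)) :
    ∃ E S Z : ℕ → Submodule ℝ X, (∀ n, FiniteDimensional ℝ (E n)) ∧
      (∀ n : ℕ, ¬ IsComplementedWith (E n) n) ∧ (∀ n, S (n + 1) = S n ⊔ E n) ∧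
      (∀ n, E n ≤ Z n) ∧ Antitone Z ∧ ∀ n, ∀ s ∈ S n, ∀ z ∈ Z n, ‖s‖ ≤ 2 * ‖s + z‖ := by
  let State := {p : Submodule ℝ X × Submodule ℝ X // FiniteDimensional ℝ p.1 ∧
    ¬ UniformlyComplemented p.2 ∧ ∀ s ∈ p.1, ∀ z ∈ p.2, ‖s‖ ≤ 2 * ‖s + z‖}
  have hstep : ∀ (n : ℕ) (p : State), ∃ (E : Submodule ℝ X) (q : State),
      FiniteDimensional ℝ E ∧ ¬ IsComplementedWith E n ∧ q.1.1 = p.1.1 ⊔ E ∧ E ≤ p.1.2 ∧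
        q.1.2 ≤ p.1.2 := by
    rintro n ⟨⟨S, Z⟩, hS, hZ, -⟩
    have : ∃ E ≤ Z, FiniteDimensional ℝ E ∧ ¬ IsComplementedWith E n := by
      by_contra! hcon
      exact hZ ⟨n, hcon⟩
    obtain ⟨E, hEZ, hE, hEn⟩ := this
    have hS : FiniteDimensional ℝ S := hS
    have : FiniteDimensional ℝ (S ⊔ E : Submodule ℝ X) := inferInstance
    obtain ⟨Φ, hΦ⟩ := exists_finset_norm_le_two_mul (S ⊔ E)
    exact ⟨E, ⟨⟨S ⊔ E, Z ⊓ ⨅ φ ∈ Φ, LinearMap.ker φ⟩, this,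
      fun hc => hZ (UniformlyComplemented.of_inf_iInf_ker Φ hc),
      fun s hs z hz => hΦ s hs z hz.2⟩, hE, hEn, rfl, hEZ, inf_le_left⟩
  choose E q hE hEn hS hEZ hZ using hstep
  let p₀ : State := ⟨⟨⊥, ⊤⟩, inferInstanceAs (FiniteDimensional ℝ (⊥ : Submodule ℝ X)), h, by
    rintro s hs z -
    rw [(Submodule.mem_bot ℝ).mp hs, norm_zero]
    positivity⟩
  let p : ℕ → State := fun n => Nat.rec p₀ q n
  exact ⟨fun n => E n (p n), fun n => (p n).1.1, fun n => (p n).1.2, fun n => hE n _,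
    fun n => hEn n _, fun n => hS n (p n), fun n => hEZ n _,
    antitone_nat_of_succ_le fun n => hZ n (p n), fun n => (p n).2.2.2⟩

/-- If every compact convex set is a Lipschitz retract, then finite-dimensional subspaces are
uniformly complemented. -/
theorem uniformlyComplemented_of_lipschitz_retracts [CompleteSpace X]
    (h : ∀ K : Set X, K.Nonempty → Convex ℝ K → IsCompact K →
      ∃ (L : NNReal) (R : X → X), LipschitzWith L R ∧ (∀ x, R x ∈ K) ∧ ∀ k ∈ K, R k = k) :
    UniformlyComplemented (⊤ : Submodule ℝ X) := by
  by_contra hcon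
  obtain ⟨E, S, Z, hE, hEn, hES, hEZ, hZ, hsep⟩ := exists_separated_sequence hcon
  set r : ℕ → ℝ := fun n => (1 / 2) ^ n
  have hrsum : Summable r := summable_geometric_two
  set D : Set (ℕ → X) := Set.pi Set.univ fun n => (E n : Set X) ∩ closedBall 0 (r n)
  have hDmem : ∀ {c}, c ∈ D ↔ ∀ n, c n ∈ E n ∧ ‖c n‖ ≤ r n := by
    intro c; simp [D, Set.mem_pi]
  have hDsum : ∀ c ∈ D, Summable c := fun c hc =>
    Summable.of_norm_bounded hrsum fun n => (hDmem.mp hc n).2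
  have hDcpt : IsCompact D := isCompact_univ_pi fun n => by
    have : ProperSpace (E n) := FiniteDimensional.proper ℝ (E n)
    convert (isCompact_closedBall (0 : E n) (r n)).image continuous_subtype_val using 1
    ext x
    simp [and_comm]
  have hDconv : Convex ℝ D := convex_pi fun n _ => (E n).convex.inter (convex_closedBall _ _)
  have hcont : ContinuousOn (fun c : ℕ → X => ∑' n, c n) D :=
    continuousOn_tsum (fun n => (continuous_apply n).continuousOn) hrsum
      fun n c hc => (hDmem.mp hc n).2
  set K : Set X := (fun c : ℕ → X => ∑' n, c n) '' D
  have hKconv : Convex ℝ K := by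
    rintro _ ⟨c, hc, rfl⟩ _ ⟨d, hd, rfl⟩ a b ha hb hab
    refine ⟨a • c + b • d, hDconv hc hd ha hb hab, ?_⟩
    have h1 := (hDsum c hc).hasSum.const_smul a
    have h2 := (hDsum d hd).hasSum.const_smul b
    exact (h1.add h2).tsum_eq
  have h0D : (0 : ℕ → X) ∈ D := hDmem.mpr fun n => ⟨(E n).zero_mem, by simp [r]⟩
  obtain ⟨L, R, hRL, hRK, hRfix⟩ := h K ⟨_, 0, h0D, rfl⟩ hKconv (hDcpt.image_of_continuousOn hcont)
  choose g hgD hg using hRK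
  have hgsum : ∀ x, HasSum (g x) (R x) := fun x => by
    have := (hDsum _ (hgD x)).hasSum
    rwa [show ∑' n, g x n = R x from hg x] at this
  have hcoord : ∀ n {c d : ℕ → X} {x y : X}, c ∈ D → d ∈ D → HasSum c x → HasSum d y →
      ‖c n - d n‖ ≤ 4 * ‖x - y‖ := fun n c d x y hc hd hx hy =>
    norm_coord_le_of_separated hES hEZ hZ hsep
      (fun i => (E i).sub_mem (hDmem.mp hc i).1 (hDmem.mp hd i).1) (hx.sub hy) n
  have hcompl : ∀ n, IsComplementedWith (E n) (4 * L) := by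
    intro n
    refine isComplementedWith_of_lipschitz (E n) (r := r n) (by positivity)
      (fun x => ⟨g x n, (hDmem.mp (hgD x) n).1⟩) (fun x y => ?_) (fun e he => ?_)
    · change ‖g x n - g y n‖ ≤ _
      refine (hcoord n (hgD x) (hgD y) (hgsum x) (hgsum y)).trans ?_
      have := hRL.dist_le_mul x y
      rw [dist_eq_norm, dist_eq_norm] at this
      rw [mul_assoc]
      gcongr
    · have hsD : Pi.single n (e : X) ∈ D := hDmem.mpr fun i => by
        rcases eq_or_ne i n with rfl | hi
        · simpa using he
        · simp [hi, r]
      have hsum : HasSum (Pi.single n (e : X)) (e : X) := hasSum_pi_single n (e : X)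
      have hRe : R e = e := hRfix _ ⟨_, hsD, hsum.tsum_eq⟩
      have := hcoord n (hgD e) hsD (hgsum e) hsum
      rw [hRe, sub_self, norm_zero, mul_zero, norm_le_zero_iff, sub_eq_zero] at this
      exact Subtype.ext (by simpa using this)
  obtain ⟨n, hn⟩ := exists_nat_ge (4 * (L : ℝ))
  exact hEn n ((hcompl n).mono hn)

end UniformComplementation

section DvoretzkyRogers

theorem det_id_add_starProjection {V : Type*} [NormedAddCommGroup V] [InnerProductSpace ℝ V]
    [FiniteDimensional ℝ V] (W : Submodule ℝ V) :
    LinearMap.det (LinearMap.id + (W.starProjection : V →ₗ[ℝ] V)) =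
      2 ^ Module.finrank ℝ W := by
  let e := W.prodEquivOfIsCompl _ W.isCompl_orthogonal
  have : e.symm.toLinearMap ∘ₗ (LinearMap.id + (W.starProjection : V →ₗ[ℝ] V)) ∘ₗ
      e.symm.symm.toLinearMap =
      LinearMap.prodMap ((2 : ℝ) • (LinearMap.id : W →ₗ[ℝ] W)) (LinearMap.id : Wᗮ →ₗ[ℝ] Wᗮ) := by
    apply LinearMap.ext
    rintro ⟨w, w'⟩
    simp only [LinearMap.comp_apply, LinearEquiv.symm_symm, LinearEquiv.coe_coe]
    rw [LinearEquiv.symm_apply_eq]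
    have h1 : W.starProjection (w : V) = w := Submodule.starProjection_eq_self_iff.mpr w.2
    have h2 : W.starProjection (w' : V) = 0 :=
      (Submodule.starProjection_apply_eq_zero_iff W).mpr w'.2
    simp [e, Submodule.coe_prodEquivOfIsCompl', h1, h2, two_smul]
    abel
  rw [← LinearMap.det_conj _ e.symm, this, LinearMap.det_prodMap, LinearMap.det_smul]
  simp

variable {Z : Type*} [NormedAddCommGroup Z] [NormedSpace ℝ Z]

/-- An operator into `Z` that maximizes the determinant under a norm constraint. -/
theorem exists_max_det {V : Type*} [NormedAddCommGroup V] [InnerProductSpace ℝ V]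
    [FiniteDimensional ℝ V] (Ψ : V →L[ℝ] Z) (hΨ : Function.Injective Ψ) :
    ∃ A : V →L[ℝ] V, ‖Ψ ∘L A‖ ≤ 1 ∧ A.det ≠ 0 ∧
      ∀ B : V →L[ℝ] V, ‖Ψ ∘L B‖ ≤ 1 → |B.det| ≤ |A.det| := by
  set F : Set (V →L[ℝ] V) := {A | ‖Ψ ∘L A‖ ≤ 1}
  have hclosed : IsClosed F := isClosed_le (by fun_prop) continuous_const
  obtain ⟨K, hK, hanti⟩ := (Ψ : V →ₗ[ℝ] Z).exists_antilipschitzWith (LinearMap.ker_eq_bot.mpr hΨ)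
  have hanti : ∀ v, ‖v‖ ≤ K * ‖Ψ v‖ := fun v => by
    simpa using hanti.le_mul_dist v 0
  have : ProperSpace (V →L[ℝ] V) := FiniteDimensional.proper ℝ _
  have hcpt : IsCompact F := by
    refine (isCompact_closedBall (0 : V →L[ℝ] V) K).of_isClosed_subset hclosed fun A hA => ?_
    rw [mem_closedBall_zero_iff]
    refine A.opNorm_le_bound K.2 fun v => (hanti (A v)).trans ?_
    have := (Ψ ∘L A).le_of_opNorm_le hA v
    rw [one_mul] at this
    gcongr
    exact this
  obtain ⟨A, hA, hmax⟩ := hcpt.exists_isMaxOn ⟨0, by simp [F]⟩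
    (ContinuousLinearMap.continuous_det (𝕜 := ℝ) (E := V)).abs.continuousOn
  refine ⟨A, hA, fun h0 => ?_, fun B hB => hmax hB⟩
  set ε : ℝ := (‖Ψ‖ + 1)⁻¹
  have hε : 0 < ε := by positivity
  have hεF : ε • ContinuousLinearMap.id ℝ V ∈ F := by
    change ‖Ψ ∘L (ε • ContinuousLinearMap.id ℝ V)‖ ≤ 1
    rw [ContinuousLinearMap.comp_smul, ContinuousLinearMap.comp_id, norm_smul,
      Real.norm_of_nonneg hε.le, inv_mul_le_one₀ (by positivity)]
    linarith
  have h1 := hmax hεF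
  have h2 : (ε • ContinuousLinearMap.id ℝ V).det = ε ^ Module.finrank ℝ V := by
    simp [ContinuousLinearMap.det]
  simp only [Set.mem_ofPred_eq, h0, abs_zero, h2] at h1
  exact absurd h1 (not_le.mpr (by positivity))

/-- **Dvoretzky–Rogers**: there are arbitrarily many vectors bounded below whose synthesis
operator from Euclidean space is a contraction. -/
theorem exists_dvoretzky_rogers (hZ : ¬ FiniteDimensional ℝ Z) (N : ℕ) :
    ∃ x : Fin N → Z, (∀ i, 1 / 4 ≤ ‖x i‖) ∧
      ∀ a : Fin N → ℝ, ‖∑ i, a i • x i‖ ^ 2 ≤ ∑ i, a i ^ 2 := by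
  let V := EuclideanSpace ℝ (Fin (2 * N))
  obtain ⟨f, hf⟩ : ∃ f : Fin (2 * N) → Z, LinearIndependent ℝ f := by
    apply exists_linearIndependent_of_le_rank
    have : Cardinal.aleph0 ≤ Module.rank ℝ Z := by
      rw [← not_lt, Module.rank_lt_aleph0_iff]
      exact hZ
    exact (Cardinal.natCast_lt_aleph0).le.trans this
  let Ψ : V →L[ℝ] Z := LinearMap.toContinuousLinearMap
    ((Fintype.linearCombination ℝ f) ∘ₗ (WithLp.linearEquiv 2 ℝ (Fin (2 * N) → ℝ)).toLinearMap)
  have hΨ : Function.Injective Ψ :=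
    hf.fintypeLinearCombination_injective.comp (WithLp.linearEquiv 2 ℝ _).injective
  obtain ⟨A, hA, hdet, hmax⟩ := exists_max_det Ψ hΨ
  have hAn : ∀ v, ‖Ψ (A v)‖ ≤ ‖v‖ := fun v => by
    simpa using (Ψ ∘L A).le_of_opNorm_le hA v
  -- the operator is bounded below somewhere on every large subspace
  have hbig : ∀ W : Submodule ℝ V, N ≤ Module.finrank ℝ W → 0 < N →
      ∃ w ∈ W, ‖w‖ = 1 ∧ 1 / 4 ≤ ‖Ψ (A w)‖ := by
    intro W hW hN
    by_contra! hcon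
    have hsmall : ∀ w ∈ W, ‖Ψ (A w)‖ ≤ 1 / 4 * ‖w‖ := by
      intro w hw
      rcases eq_or_ne w 0 with rfl | hw0
      · simp
      have hn : 0 < ‖w‖ := norm_pos_iff.mpr hw0
      have := hcon (‖w‖⁻¹ • w) (W.smul_mem _ hw) (by
        rw [norm_smul, norm_inv, norm_norm, inv_mul_cancel₀ hn.ne'])
      rw [map_smul, map_smul, norm_smul, norm_inv, norm_norm, inv_mul_lt_iff₀ hn] at this
      linarith
    let B : V →L[ℝ] V := (4 / 5 : ℝ) • (A ∘L (ContinuousLinearMap.id ℝ V + W.starProjection))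
    have hB : ‖Ψ ∘L B‖ ≤ 1 := by
      refine ContinuousLinearMap.opNorm_le_bound _ zero_le_one fun v => ?_
      have h1 : (Ψ ∘L B) v = (4 / 5 : ℝ) • (Ψ (A v) + Ψ (A (W.starProjection v))) := by
        simp [B]
      have h2 : ‖W.starProjection v‖ ≤ ‖v‖ := by
        simpa using W.starProjection.le_of_opNorm_le W.starProjection_norm_le v
      have h3 := hsmall _ (W.starProjection_apply_mem v)
      rw [h1, norm_smul, Real.norm_of_nonneg (by norm_num)]
      have := norm_add_le (Ψ (A v)) (Ψ (A (W.starProjection v)))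
      linarith [hAn v]
    have hBdet : B.det = (4 / 5 : ℝ) ^ (2 * N) * (A.det * 2 ^ Module.finrank ℝ W) := by
      have : (B : V →ₗ[ℝ] V) = (4 / 5 : ℝ) •
        ((A : V →ₗ[ℝ] V) ∘ₗ (LinearMap.id + (W.starProjection : V →ₗ[ℝ] V))) := rfl
      rw [ContinuousLinearMap.det, this, LinearMap.det_smul, LinearMap.det_comp,
        det_id_add_starProjection, ContinuousLinearMap.det]
      simp [V]
    have h := hmax B hB
    rw [hBdet, abs_mul, abs_mul, mul_left_comm] at h
    have hpos : 0 < |A.det| := abs_pos.mpr hdet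
    have h' := le_of_mul_le_mul_left (h.trans_eq (mul_one _).symm) hpos
    rw [abs_of_pos (by positivity), abs_of_pos (by positivity)] at h'
    have h4 : (1 : ℝ) < (32 / 25) ^ N := one_lt_pow₀ (by norm_num) hN.ne'
    have h5 : ((32 : ℝ) / 25) ^ N ≤ (4 / 5 : ℝ) ^ (2 * N) * 2 ^ Module.finrank ℝ W := by
      calc ((32 : ℝ) / 25) ^ N = (4 / 5 : ℝ) ^ (2 * N) * 2 ^ N := by
            rw [pow_mul, ← mul_pow]; norm_num
        _ ≤ _ := by gcongr; norm_num
    linarith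
  -- greedy choice of an orthonormal family
  have hgreedy : ∀ j ≤ N, ∃ u : Fin j → V, Orthonormal ℝ u ∧ ∀ i, 1 / 4 ≤ ‖Ψ (A (u i))‖ := by
    intro j
    induction j with
    | zero => exact fun _ => ⟨Fin.elim0, ⟨fun i => i.elim0, fun i => i.elim0⟩, fun i => i.elim0⟩
    | succ j ih =>
      intro hj
      obtain ⟨u, hu, hlow⟩ := ih (by omega)
      obtain ⟨w, hw, hw1, hwlow⟩ := hbig (Submodule.span ℝ (Set.range u))ᗮ (by
        have h1 := (Submodule.span ℝ (Set.range u)).finrank_add_finrank_orthogonal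
        have h2 : Module.finrank ℝ (Submodule.span ℝ (Set.range u)) = j := by
          simpa using finrank_span_eq_card hu.linearIndependent
        have h3 : Module.finrank ℝ V = 2 * N := by simp [V]
        omega) (by omega)
      refine ⟨Matrix.vecCons w u, orthonormal_vecCons_iff.mpr ⟨hw1, fun i => ?_, hu⟩, fun i => ?_⟩
      · rw [real_inner_comm]
        exact (Submodule.mem_orthogonal _ _).mp hw _ (Submodule.subset_span ⟨i, rfl⟩)
      · refine Fin.cases ?_ (fun i => ?_) i
        · simpa using hwlow
        · simpa using hlow i
  obtain ⟨u, hu, hlow⟩ := hgreedy N le_rfl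
  refine ⟨fun i => Ψ (A (u i)), hlow, fun a => ?_⟩
  have h1 : ∑ i, a i • Ψ (A (u i)) = Ψ (A (∑ i, a i • u i)) := by simp
  have h2 : ‖∑ i, a i • u i‖ ^ 2 = ∑ i, a i ^ 2 := by
    rw [← real_inner_self_eq_norm_sq, hu.inner_sum]
    simp [sq]
  rw [h1, ← h2]
  gcongr
  exact hAn _

end DvoretzkyRogers

section EfronStein

open MeasureTheory

variable {B C : Type*} [TopologicalSpace B] [CompactSpace B] [SecondCountableTopology B]
  [T2Space B] [MeasurableSpace B] [BorelSpace B]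
  [TopologicalSpace C] [CompactSpace C] [SecondCountableTopology C] [T2Space C]
  [MeasurableSpace C] [BorelSpace C]

omit [SecondCountableTopology B] [T2Space B] in
theorem integrable_of_continuous_of_compactSpace (μ : Measure B) [IsFiniteMeasure μ]
    {f : B → ℝ} (hf : Continuous f) : Integrable f μ :=
  hf.integrable_of_hasCompactSupport (HasCompactSupport.of_compactSpace f)

omit [MeasurableSpace B] [BorelSpace B] in
theorem continuous_integral_of_compactSpace (ν : Measure C) [IsFiniteMeasure ν] {f : B → C → ℝ}
    (hf : Continuous f.uncurry) : Continuous fun b => ∫ c, f b c ∂ν := by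
  simpa using continuous_parametric_integral_of_continuous (μ := ν) hf isCompact_univ

omit [T2Space B] [T2Space C] in
theorem integral_integral_swap_of_continuous (μ : Measure B) [IsFiniteMeasure μ] (ν : Measure C)
    [IsFiniteMeasure ν] {f : B → C → ℝ} (hf : Continuous f.uncurry) :
    ∫ b, ∫ c, f b c ∂ν ∂μ = ∫ c, ∫ b, f b c ∂μ ∂ν :=
  integral_integral_swap (integrable_of_continuous_of_compactSpace (μ.prod ν) hf)

omit [SecondCountableTopology B] [T2Space B] in
theorem integral_sub_const_sq (μ : Measure B) [IsProbabilityMeasure μ] {f : B → ℝ}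
    (hf : Continuous f) (m : ℝ) :
    ∫ b, (f b - m) ^ 2 ∂μ = ∫ b, f b ^ 2 ∂μ - 2 * m * ∫ b, f b ∂μ + m ^ 2 := by
  have h1 := integrable_of_continuous_of_compactSpace μ (f := fun b => f b ^ 2) (hf.pow 2)
  have h2 := (integrable_of_continuous_of_compactSpace μ hf).const_mul (2 * m)
  calc ∫ b, (f b - m) ^ 2 ∂μ = ∫ b, (f b ^ 2 - 2 * m * f b + m ^ 2) ∂μ := by
        congr 1; ext b; ring
    _ = _ := by
      rw [integral_add (f := fun b => f b ^ 2 - 2 * m * f b) (h1.sub h2) (integrable_const _),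
        integral_sub h1 h2, integral_const_mul]
      simp

omit [SecondCountableTopology B] [T2Space B] in
theorem sq_integral_le_integral_sq (μ : Measure B) [IsProbabilityMeasure μ] {f : B → ℝ}
    (hf : Continuous f) : (∫ b, f b ∂μ) ^ 2 ≤ ∫ b, f b ^ 2 ∂μ := by
  have h := integral_sub_const_sq μ hf (∫ b, f b ∂μ)
  have h0 : 0 ≤ ∫ b, (f b - ∫ b, f b ∂μ) ^ 2 ∂μ := integral_nonneg fun b => sq_nonneg _
  nlinarith

theorem integral_sq_sub_sq_integral_eq (μ : Measure B) [IsProbabilityMeasure μ] {f : B → ℝ}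
    (hf : Continuous f) :
    ∫ b, f b ^ 2 ∂μ - (∫ b, f b ∂μ) ^ 2 = ∫ b, ∫ b', max (f b - f b') 0 ^ 2 ∂μ ∂μ := by
  have hc : ∀ b, ∫ b', (f b' - f b) ^ 2 ∂μ = ∫ b', max (f b - f b') 0 ^ 2 ∂μ
      + ∫ b', max (f b' - f b) 0 ^ 2 ∂μ := fun b => by
    rw [← integral_add (integrable_of_continuous_of_compactSpace μ (by fun_prop))
      (integrable_of_continuous_of_compactSpace μ (by fun_prop))]
    congr 1; ext b'
    rcases le_total (f b) (f b') with h | h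
    · rw [max_eq_right (by linarith), max_eq_left (by linarith)]; ring
    · rw [max_eq_left (by linarith), max_eq_right (by linarith)]; ring
  have hs : ∫ b, ∫ b', max (f b' - f b) 0 ^ 2 ∂μ ∂μ = ∫ b, ∫ b', max (f b - f b') 0 ^ 2 ∂μ ∂μ :=
    integral_integral_swap_of_continuous μ μ (f := fun b b' => max (f b' - f b) 0 ^ 2)
      (by unfold Function.uncurry; fun_prop)
  have h2 : ∫ b, ∫ b', (f b' - f b) ^ 2 ∂μ ∂μ
      = 2 * ∫ b, ∫ b', max (f b - f b') 0 ^ 2 ∂μ ∂μ := by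
    simp_rw [hc]
    rw [integral_add, hs, two_mul] <;> apply integrable_of_continuous_of_compactSpace <;>
      apply continuous_integral_of_compactSpace <;> unfold Function.uncurry <;> fun_prop
  have h3 : ∫ b, ∫ b', (f b' - f b) ^ 2 ∂μ ∂μ
      = 2 * (∫ b, f b ^ 2 ∂μ - (∫ b, f b ∂μ) ^ 2) := by
    simp_rw [integral_sub_const_sq μ hf]
    have h1 := integrable_of_continuous_of_compactSpace μ (f := fun b => f b ^ 2) (hf.pow 2)
    have h4 := integrable_of_continuous_of_compactSpace μ
      (f := fun b => 2 * f b * ∫ b, f b ∂μ) (by fun_prop)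
    rw [integral_add (f := fun b => ∫ b, f b ^ 2 ∂μ - 2 * f b * ∫ b, f b ∂μ)
      ((integrable_const _).sub h4) h1, integral_sub (integrable_const _) h4,
      integral_mul_const, integral_const_mul]
    simp
    ring
  linarith

theorem integral_sq_sub_sq_integral_prod_le (μ : Measure B) (ν : Measure C)
    [IsProbabilityMeasure μ] [IsProbabilityMeasure ν] {f : B → C → ℝ}
    (hf : Continuous f.uncurry) :
    ∫ b, ∫ c, f b c ^ 2 ∂ν ∂μ - (∫ b, ∫ c, f b c ∂ν ∂μ) ^ 2 ≤
      ∫ c, (∫ b, f b c ^ 2 ∂μ - (∫ b, f b c ∂μ) ^ 2) ∂ν +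
      ∫ b, (∫ c, f b c ^ 2 ∂ν - (∫ c, f b c ∂ν) ^ 2) ∂μ := by
  have hf' : Continuous (fun c b => f b c).uncurry := hf.comp continuous_swap
  have hfb : ∀ b, Continuous (f b) := fun b => hf.comp (Continuous.prodMk_right b)
  have hfc : ∀ c, Continuous fun b => f b c := fun c => hf.comp (Continuous.prodMk_left c)
  set h : B → ℝ := fun b => ∫ c, f b c ∂ν
  set k : C → ℝ := fun c => ∫ b, f b c ∂μ
  have hh : Continuous h := continuous_integral_of_compactSpace ν hf
  have hk : Continuous k := continuous_integral_of_compactSpace μ hf'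
  have hf2 : Continuous fun b => ∫ c, f b c ^ 2 ∂ν :=
    continuous_integral_of_compactSpace ν (f := fun b c => f b c ^ 2) (hf.pow 2)
  have hm : ∫ c, k c ∂ν = ∫ b, h b ∂μ := (integral_integral_swap_of_continuous μ ν hf).symm
  have hd : Continuous (fun b c => (f b c - k c) ^ 2).uncurry :=
    (hf.sub (hk.comp continuous_snd)).pow 2
  have key : ∫ b, h b ^ 2 ∂μ - (∫ b, h b ∂μ) ^ 2
      ≤ ∫ c, (∫ b, f b c ^ 2 ∂μ - k c ^ 2) ∂ν := by
    calc ∫ b, h b ^ 2 ∂μ - (∫ b, h b ∂μ) ^ 2 = ∫ b, (h b - ∫ b, h b ∂μ) ^ 2 ∂μ := by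
          rw [integral_sub_const_sq μ hh]; ring
      _ ≤ ∫ b, ∫ c, (f b c - k c) ^ 2 ∂ν ∂μ := by
        refine integral_mono (integrable_of_continuous_of_compactSpace μ (by fun_prop))
          (integrable_of_continuous_of_compactSpace μ
            (continuous_integral_of_compactSpace ν hd)) fun b => ?_
        have := sq_integral_le_integral_sq ν (f := fun c => f b c - k c) ((hfb b).sub hk)
        rwa [integral_sub (integrable_of_continuous_of_compactSpace ν (hfb b))
          (integrable_of_continuous_of_compactSpace ν hk), hm] at this
      _ = ∫ c, ∫ b, (f b c - k c) ^ 2 ∂μ ∂ν := integral_integral_swap_of_continuous μ ν hd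
      _ = _ := by
        congr 1; ext c
        rw [integral_sub_const_sq μ (hfc c)]
        change _ - 2 * k c * k c + _ = _
        ring
  have hsplit : ∫ b, (∫ c, f b c ^ 2 ∂ν - h b ^ 2) ∂μ
      = ∫ b, ∫ c, f b c ^ 2 ∂ν ∂μ - ∫ b, h b ^ 2 ∂μ :=
    integral_sub (integrable_of_continuous_of_compactSpace μ hf2)
      (integrable_of_continuous_of_compactSpace μ (hh.pow 2))
  linarith

omit [CompactSpace B] [SecondCountableTopology B] [T2Space B] [MeasurableSpace B]
  [BorelSpace B] in
theorem continuous_cons (n : ℕ) :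
    Continuous fun p : B × (Fin n → B) => (Fin.cons p.1 p.2 : Fin (n + 1) → B) :=
  Continuous.finCons continuous_fst continuous_snd

theorem integral_pi_succ (μ : Measure B) [IsProbabilityMeasure μ] (n : ℕ)
    {f : (Fin (n + 1) → B) → ℝ} (hf : Continuous f) :
    ∫ ω, f ω ∂(Measure.pi fun _ => μ) =
      ∫ b, ∫ ω, f (Fin.cons b ω) ∂(Measure.pi fun _ => μ) ∂μ := by
  have h := (measurePreserving_piFinSuccAbove (fun _ : Fin (n + 1) => μ) 0).symm
  have : ∀ p : B × (Fin n → B), (MeasurableEquiv.piFinSuccAbove (fun _ => B) 0).symm p =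
      Fin.cons p.1 p.2 := fun p => by
    simp [MeasurableEquiv.piFinSuccAbove, Fin.insertNthEquiv]
  rw [← h.integral_comp (MeasurableEquiv.measurableEmbedding _)]
  rw [integral_prod _ (integrable_of_continuous_of_compactSpace _ _)]
  · simp_rw [this]
  · simpa only [this, Function.comp_def] using hf.comp (continuous_cons n)

theorem efron_stein (μ : Measure B) [IsProbabilityMeasure μ] (n : ℕ) {f : (Fin n → B) → ℝ}
    (hf : Continuous f) :
    ∫ ω, f ω ^ 2 ∂(Measure.pi fun _ => μ) - (∫ ω, f ω ∂(Measure.pi fun _ => μ)) ^ 2 ≤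
      ∑ i, ∫ ω, ∫ b, max (f ω - f (Function.update ω i b)) 0 ^ 2 ∂μ ∂(Measure.pi fun _ => μ) := by
  induction n with
  | zero => simp [integral_unique]
  | succ n ih =>
    have hup : ∀ i, Continuous fun p : (Fin (n + 1) → B) × B => Function.update p.1 i p.2 :=
      fun i => continuous_fst.update i continuous_snd
    have hD : ∀ i, Continuous fun ω : Fin (n + 1) → B =>
        ∫ b, max (f ω - f (Function.update ω i b)) 0 ^ 2 ∂μ := fun i =>
      continuous_integral_of_compactSpace μ
        (f := fun ω b => max (f ω - f (Function.update ω i b)) 0 ^ 2)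
        (((hf.comp continuous_fst).sub (hf.comp (hup i))).max continuous_const |>.pow 2)
    have hg : Continuous (fun (b : B) (ω : Fin n → B) => f (Fin.cons b ω)).uncurry :=
      hf.comp (continuous_cons n)
    have hgb : ∀ b, Continuous fun ω : Fin n → B => f (Fin.cons b ω) := fun b =>
      hg.comp (Continuous.prodMk_right b)
    have hgc : ∀ ω : Fin n → B, Continuous fun b => f (Fin.cons b ω) := fun ω =>
      hg.comp (Continuous.prodMk_left ω)
    rw [integral_pi_succ μ n (f := fun ω => f ω ^ 2) (hf.pow 2), integral_pi_succ μ n hf, Fin.sum_univ_succ]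
    refine (integral_sq_sub_sq_integral_prod_le μ _ hg).trans (add_le_add ?_ ?_)
    · rw [integral_pi_succ μ n (hD 0), integral_integral_swap_of_continuous]
      · refine le_of_eq ?_
        congr 1; ext ω
        rw [integral_sq_sub_sq_integral_eq μ (hgc ω)]
        simp [Fin.update_cons_zero]
      · exact (hD 0).comp (continuous_cons n)
    · simp_rw [fun i => integral_pi_succ μ n (hD (Fin.succ i))]
      rw [← integral_finsetSum]
      · refine integral_mono (integrable_of_continuous_of_compactSpace μ ?_)
          (integrable_of_continuous_of_compactSpace μ ?_) fun b => ?_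
        · refine .sub ?_ (.pow ?_ 2)
          · exact continuous_integral_of_compactSpace _
              (f := fun (b : B) (ω : Fin n → B) => f (Fin.cons b ω) ^ 2) (hg.pow 2)
          · exact continuous_integral_of_compactSpace _ hg
        · refine continuous_finsetSum _ fun i _ => ?_
          exact continuous_integral_of_compactSpace _ ((hD i.succ).comp (continuous_cons n))
        · refine (ih (hgb b)).trans (le_of_eq ?_)
          simp [Fin.cons_update]
      · intro i _
        refine integrable_of_continuous_of_compactSpace μ ?_
        exact continuous_integral_of_compactSpace _ ((hD i.succ).comp (continuous_cons n))

end EfronStein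

section RandomMap

open MeasureTheory

section Invariant

variable {V : Type*} [NormedAddCommGroup V] [InnerProductSpace ℝ V] [FiniteDimensional ℝ V]
  [MeasurableSpace V] [BorelSpace V]

/-- The action of a linear isometry on the closed unit ball. -/
def closedBallMap (T : V ≃ₗᵢ[ℝ] V) (b : closedBall (0 : V) 1) : closedBall (0 : V) 1 :=
  ⟨T b, by rw [mem_closedBall_zero_iff, T.norm_map]; exact mem_closedBall_zero_iff.mp b.2⟩

theorem exists_invariant_measure : ∃ μ : Measure (closedBall (0 : V) 1), IsProbabilityMeasure μ ∧
    (∀ T : V ≃ₗᵢ[ℝ] V, MeasurePreserving (closedBallMap T) μ μ) ∧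
    ∀ e : V, ‖e‖ = 1 → 0 < μ {b | 1 / 2 ≤ inner ℝ e (b : V)} := by
  set μ₀ : Measure (closedBall (0 : V) 1) := Measure.comap Subtype.val volume
  have hball : MeasurableSet (closedBall (0 : V) 1) := measurableSet_closedBall
  have hμ₀ : ∀ s : Set (closedBall (0 : V) 1), μ₀ s = volume (Subtype.val '' s) := fun s =>
    comap_subtype_coe_apply hball volume s
  have huniv : μ₀ Set.univ = volume (closedBall (0 : V) 1) := by
    rw [hμ₀, Set.image_univ, Subtype.range_coe]
  have hpos : μ₀ Set.univ ≠ 0 := by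
    rw [huniv]
    exact (measure_closedBall_pos volume _ one_pos).ne'
  have hfin : μ₀ Set.univ ≠ ⊤ := by
    rw [huniv]
    exact measure_closedBall_lt_top.ne
  refine ⟨(μ₀ Set.univ)⁻¹ • μ₀, ⟨?_⟩, fun T => ⟨?_, ?_⟩, fun e he => ?_⟩
  · simp [ENNReal.inv_mul_cancel hpos hfin]
  · exact Measurable.subtype_mk (by fun_prop)
  · have hm : Measurable (closedBallMap T) := Measurable.subtype_mk (by fun_prop)
    rw [Measure.map_smul]
    congr 1
    ext s hs
    rw [Measure.map_apply hm hs, hμ₀, hμ₀]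
    have : (Subtype.val '' (closedBallMap T ⁻¹' s) : Set V) = T ⁻¹' (Subtype.val '' s) := by
      ext v
      simp [closedBallMap]
    rw [this]
    exact T.measurePreserving.measure_preimage_equiv (f := T.toMeasurableEquiv) _
  · have hsub : (ball ((3 / 4 : ℝ) • e) (1 / 4) : Set V) ⊆
        Subtype.val '' {b : closedBall (0 : V) 1 | 1 / 2 ≤ inner ℝ e (b : V)} := by
      intro v hv
      have hd : ‖v - (3 / 4 : ℝ) • e‖ < 1 / 4 := by simpa [dist_eq_norm] using hv
      refine ⟨⟨v, ?_⟩, ?_, rfl⟩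
      · have := norm_add_le (v - (3 / 4 : ℝ) • e) ((3 / 4 : ℝ) • e)
        rw [norm_smul, he] at this
        norm_num at this
        simp
        linarith
      · have h1 := abs_real_inner_le_norm e (v - (3 / 4 : ℝ) • e)
        rw [inner_sub_right, inner_smul_right, real_inner_self_eq_norm_sq, he] at h1
        have := abs_le.mp h1
        change 1 / 2 ≤ inner ℝ e v
        linarith [this.1]
    have h1 : 0 < μ₀ {b | 1 / 2 ≤ inner ℝ e (b : V)} := by
      rw [hμ₀]
      exact (measure_ball_pos volume _ (by norm_num)).trans_le (measure_mono hsub)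
    simp only [Measure.smul_apply, smul_eq_mul]
    exact ENNReal.mul_pos (ENNReal.inv_ne_zero.mpr hfin) h1.ne'

end Invariant

section Nested

variable {B : Type*} [TopologicalSpace B] [CompactSpace B] [SecondCountableTopology B]
  [T2Space B] [MeasurableSpace B] [BorelSpace B]

theorem variance_le_of_update (μ : Measure B) [IsProbabilityMeasure μ] (n : ℕ)
    {f : (Fin n → B) → ℝ} (hf : Continuous f) (c : ℝ)
    (h : ∀ ω, ∃ s : Fin n → ℝ, ∑ i, s i ≤ c ∧
      ∀ i b, max (f ω - f (Function.update ω i b)) 0 ^ 2 ≤ s i) :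
    ∫ ω, (f ω - ∫ ω, f ω ∂(Measure.pi fun _ => μ)) ^ 2 ∂(Measure.pi fun _ => μ) ≤ c := by
  have hD : ∀ i, Continuous fun p : (Fin n → B) × B =>
      max (f p.1 - f (Function.update p.1 i p.2)) 0 ^ 2 := fun i =>
    (((hf.comp continuous_fst).sub (hf.comp (continuous_fst.update i continuous_snd))).max
      continuous_const).pow 2
  have hDi : ∀ i, Continuous fun ω : Fin n → B =>
      ∫ b, max (f ω - f (Function.update ω i b)) 0 ^ 2 ∂μ := fun i =>
    continuous_integral_of_compactSpace μ
      (f := fun ω b => max (f ω - f (Function.update ω i b)) 0 ^ 2) (hD i)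
  have h1 := efron_stein μ n hf
  rw [← integral_finsetSum _ fun i _ => integrable_of_continuous_of_compactSpace _ (hDi i)] at h1
  have h2 : ∫ ω, ∑ i, ∫ b, max (f ω - f (Function.update ω i b)) 0 ^ 2 ∂μ
      ∂(Measure.pi fun _ => μ) ≤ ∫ _ω : Fin n → B, c ∂(Measure.pi fun _ => μ) := by
    refine integral_mono (integrable_of_continuous_of_compactSpace _
      (continuous_finsetSum _ fun i _ => hDi i)) (integrable_const _) fun ω => ?_
    obtain ⟨s, hs, hsi⟩ := h ω
    refine (Finset.sum_le_sum fun i _ => ?_).trans hs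
    have h3 : ∫ b, max (f ω - f (Function.update ω i b)) 0 ^ 2 ∂μ ≤ ∫ _b : B, s i ∂μ :=
      integral_mono (integrable_of_continuous_of_compactSpace _
        ((hD i).comp (Continuous.prodMk_right ω))) (integrable_const _) (hsi i)
    simpa using h3
  rw [integral_sub_const_sq _ hf]
  simp at h2
  linarith

/-- Reading a flat family of points as a matrix. -/
def unflatten {N m n : ℕ} (e : Fin N × Fin m ≃ Fin n) (ω : Fin n → B) : Fin N → Fin m → B :=
  fun i j => ω (e (i, j))

omit [TopologicalSpace B] [CompactSpace B] [SecondCountableTopology B] [T2Space B]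
  [BorelSpace B] in
theorem measurePreserving_unflatten (μ : Measure B) [IsProbabilityMeasure μ] {N m n : ℕ}
    (e : Fin N × Fin m ≃ Fin n) :
    MeasurePreserving (unflatten e) (Measure.pi fun _ => μ)
      (Measure.pi fun _ : Fin N => Measure.pi fun _ : Fin m => μ) := by
  have hm' : Measurable fun (η : Fin N → Fin m → B) (l : Fin n) =>
      η (e.symm l).1 (e.symm l).2 := by fun_prop
  have hm : Measurable (unflatten (B := B) e) := by unfold unflatten; fun_prop
  refine ⟨hm, ?_⟩
  have : (Measure.pi fun _ : Fin n => μ) =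
      (Measure.pi fun _ : Fin N => Measure.pi fun _ : Fin m => μ).map fun η l =>
        η (e.symm l).1 (e.symm l).2 := by
    refine Measure.pi_eq fun s hs => ?_
    rw [Measure.map_apply hm' (MeasurableSet.univ_pi hs)]
    have : ((fun (η : Fin N → Fin m → B) (l : Fin n) =>
        η (e.symm l).1 (e.symm l).2) ⁻¹' Set.pi Set.univ s) =
        Set.pi Set.univ fun i => Set.pi Set.univ fun j => s (e (i, j)) := by
      ext η
      simp only [Set.mem_preimage, Set.mem_univ_pi]
      refine ⟨fun h i j => by simpa using h (e (i, j)), fun h l => ?_⟩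
      simpa using h (e.symm l).1 (e.symm l).2
    rw [this, Measure.pi_pi]
    simp_rw [Measure.pi_pi]
    rw [← Fintype.prod_prod_type', ← e.prod_comp]
  rw [this, Measure.map_map hm hm']
  convert Measure.map_id
  ext η i j
  simp [unflatten]

theorem variance_le_of_update_nested (μ : Measure B) [IsProbabilityMeasure μ] (N m : ℕ)
    {f : (Fin N → Fin m → B) → ℝ} (hf : Continuous f) (c : ℝ)
    (h : ∀ ω, ∃ s : Fin N → Fin m → ℝ, ∑ i, ∑ j, s i j ≤ c ∧
      ∀ i j b, max (f ω - f (Function.update ω i (Function.update (ω i) j b))) 0 ^ 2 ≤ s i j) :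
    ∫ ω, (f ω - ∫ ω, f ω ∂(Measure.pi fun _ => Measure.pi fun _ => μ)) ^ 2
      ∂(Measure.pi fun _ => Measure.pi fun _ => μ) ≤ c := by
  let e : Fin N × Fin m ≃ Fin (N * m) := finProdFinEquiv
  have hmp := measurePreserving_unflatten μ e
  have hc : Continuous (unflatten (B := B) e) := by unfold unflatten; fun_prop
  have hint : ∀ g : (Fin N → Fin m → B) → ℝ, Continuous g →
      ∫ ω, g ω ∂(Measure.pi fun _ => Measure.pi fun _ => μ) =
        ∫ ω, g (unflatten e ω) ∂(Measure.pi fun _ => μ) := fun g hg => by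
    rw [← hmp.map_eq, integral_map hmp.measurable.aemeasurable hg.aestronglyMeasurable]
  rw [hint _ hf, hint _ (by fun_prop)]
  refine variance_le_of_update μ (N * m) (hf.comp hc) c fun ω => ?_
  obtain ⟨s, hs, hsi⟩ := h (unflatten e ω)
  refine ⟨fun l => s (e.symm l).1 (e.symm l).2, ?_, fun l b => ?_⟩
  · rw [← e.sum_comp, Fintype.sum_prod_type]
    simpa using hs
  · have hu : unflatten e (Function.update ω l b) = Function.update (unflatten e ω) (e.symm l).1
        (Function.update (unflatten e ω (e.symm l).1) (e.symm l).2 b) := by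
      ext i j
      by_cases hij : e (i, j) = l
      · subst hij
        simp [unflatten]
      · have : ¬ (i = (e.symm l).1 ∧ j = (e.symm l).2) := by
          rintro ⟨rfl, rfl⟩
          simp at hij
        rcases eq_or_ne i (e.symm l).1 with rfl | hi
        · have hj : j ≠ (e.symm l).2 := fun hj => this ⟨rfl, hj⟩
          rw [Function.update_self, Function.update_of_ne hj]
          simp [unflatten, Function.update_of_ne hij]
        · simp [unflatten, Function.update_of_ne hij, Function.update_of_ne hi]
    simpa only [Function.comp_apply, hu] using hsi (e.symm l).1 (e.symm l).2 b

end Nested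

end RandomMap

section Dvoretzky

open MeasureTheory

variable {V : Type*} [NormedAddCommGroup V] [InnerProductSpace ℝ V] [FiniteDimensional ℝ V]
  {Z : Type*} [NormedAddCommGroup Z] [NormedSpace ℝ Z]

omit [FiniteDimensional ℝ V] in
theorem norm_bounds_of_net (G : V →L[ℝ] Z) (net : Set V)
    (hnet : ∀ a : V, ‖a‖ = 1 → ∃ y ∈ net, ‖a - y‖ ≤ 1 / 8) {M : ℝ} (hM : 0 ≤ M)
    (h : ∀ y ∈ net, |‖G y‖ - M| ≤ M / 8) (a : V) :
    5 / 7 * M * ‖a‖ ≤ ‖G a‖ ∧ ‖G a‖ ≤ 9 / 7 * M * ‖a‖ := by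
  have hnear : ∀ a : V, ‖a‖ = 1 →
      7 / 8 * M - ‖G‖ / 8 ≤ ‖G a‖ ∧ ‖G a‖ ≤ 9 / 8 * M + ‖G‖ / 8 := fun a ha => by
    obtain ⟨y, hy, hay⟩ := hnet a ha
    have h1 := abs_le.mp (h y hy)
    have h2 : |‖G a‖ - ‖G y‖| ≤ ‖G‖ / 8 := calc
      |‖G a‖ - ‖G y‖| ≤ ‖G a - G y‖ := abs_norm_sub_norm_le _ _
      _ = ‖G (a - y)‖ := by rw [map_sub]
      _ ≤ ‖G‖ * ‖a - y‖ := G.le_opNorm _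
      _ ≤ ‖G‖ * (1 / 8) := by gcongr
      _ = ‖G‖ / 8 := by ring
    have h3 := abs_le.mp h2
    constructor <;> linarith
  have hsphere : ∀ a : V, a ≠ 0 → ‖G a‖ = ‖a‖ * ‖G (‖a‖⁻¹ • a)‖ := fun a ha => by
    rw [map_smul, norm_smul, norm_inv, norm_norm, mul_inv_cancel_left₀ (norm_ne_zero_iff.mpr ha)]
  have hunit : ∀ a : V, a ≠ 0 → ‖‖a‖⁻¹ • a‖ = 1 := fun a ha => norm_smul_inv_norm (𝕜 := ℝ) ha
  have hG : ‖G‖ ≤ 9 / 8 * M + ‖G‖ / 8 := by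
    refine G.opNorm_le_bound (by positivity) fun a => ?_
    rcases eq_or_ne a 0 with rfl | ha
    · simp
    · rw [hsphere a ha, mul_comm]
      gcongr
      exact (hnear _ (hunit a ha)).2
  rcases eq_or_ne a 0 with rfl | ha
  · simp
  · rw [hsphere a ha]
    have := hnear _ (hunit a ha)
    constructor
    · rw [mul_comm]
      gcongr
      linarith [this.1]
    · rw [mul_comm _ ‖a‖]
      gcongr
      linarith [this.2]

theorem exists_finset_net : ∃ net : Finset V,
    ∀ a : V, ‖a‖ = 1 → ∃ y ∈ net, ‖y‖ = 1 ∧ ‖a - y‖ ≤ 1 / 8 := by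
  have : ProperSpace V := FiniteDimensional.proper ℝ V
  obtain ⟨t, htS, hfin, hcov⟩ := (isCompact_sphere (0 : V) 1).finite_cover_balls
    (show (0 : ℝ) < 1 / 8 by norm_num)
  refine ⟨hfin.toFinset, fun a ha => ?_⟩
  have := hcov (mem_sphere_zero_iff_norm.mpr ha)
  simp only [Set.mem_iUnion, mem_ball, dist_eq_norm, exists_prop] at this
  obtain ⟨y, hy, hay⟩ := this
  exact ⟨y, by simpa using hy, mem_sphere_zero_iff_norm.mp (htS hy), hay.le⟩

theorem sum_norm_signs_ge (N : ℕ) (v : Fin N → Z) (i : Fin N) :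
    2 ^ N * ‖v i‖ ≤ ∑ ε : Fin N → ℤˣ, ‖∑ l, ((ε l : ℤ) : ℝ) • v l‖ := by
  let τ : (Fin N → ℤˣ) ≃ (Fin N → ℤˣ) := Equiv.mulLeft fun l => if l = i then 1 else -1
  have h1 : ∑ ε : Fin N → ℤˣ, ‖∑ l, ((τ ε l : ℤ) : ℝ) • v l‖ =
      ∑ ε : Fin N → ℤˣ, ‖∑ l, ((ε l : ℤ) : ℝ) • v l‖ :=
    τ.sum_comp fun ε : Fin N → ℤˣ => ‖∑ l, ((ε l : ℤ) : ℝ) • v l‖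
  have h2 : ∀ ε : Fin N → ℤˣ, 2 * ‖v i‖ ≤
      ‖∑ l, ((ε l : ℤ) : ℝ) • v l‖ + ‖∑ l, ((τ ε l : ℤ) : ℝ) • v l‖ := fun ε => by
    refine le_trans (le_of_eq ?_) (norm_add_le _ _)
    rw [← Finset.sum_add_distrib, Finset.sum_eq_single i]
    · have : τ ε i = ε i := by simp [τ]
      rw [this, ← two_smul ℝ, norm_smul, norm_smul]
      rcases Int.units_eq_one_or (ε i) with h | h <;> simp [h]
    · intro l _ hl
      have : τ ε l = - ε l := by simp [τ, hl]
      simp [this]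
    · simp
  have h3 := Finset.sum_le_sum fun ε (_ : ε ∈ (Finset.univ : Finset (Fin N → ℤˣ))) => h2 ε
  rw [Finset.sum_add_distrib, h1] at h3
  simp at h3
  linarith

theorem sum_sq_dual_le_one {N : ℕ} {x : Fin N → Z}
    (hx : ∀ a : Fin N → ℝ, ‖∑ i, a i • x i‖ ^ 2 ≤ ∑ i, a i ^ 2) (φ : Z →L[ℝ] ℝ) (hφ : ‖φ‖ ≤ 1) :
    ∑ i, φ (x i) ^ 2 ≤ 1 := by
  set s := ∑ i, φ (x i) ^ 2
  have h1 : s = φ (∑ i, φ (x i) • x i) := by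
    simp [s, sq]
  have h2 : s ≤ ‖∑ i, φ (x i) • x i‖ := by
    rw [h1]
    exact (le_abs_self _).trans (φ.le_of_opNorm_le hφ _ |>.trans (by simp))
  have h3 := hx fun i => φ (x i)
  have h0 : 0 ≤ s := Finset.sum_nonneg fun i _ => sq_nonneg _
  have h4 : s ^ 2 ≤ s := (pow_le_pow_left₀ h0 h2 2).trans h3
  by_contra! h
  nlinarith

/-- The random operator attached to a matrix of points of the ball and vectors `x i`. -/
noncomputable def randomMap {N m : ℕ} (x : Fin N → Z) (ω : Fin N → Fin m → closedBall (0 : V) 1) : V →L[ℝ] Z :=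
  ∑ i, (∑ j, innerSL ℝ (ω i j : V)).smulRight (x i)

omit [FiniteDimensional ℝ V] in
theorem randomMap_apply {N m : ℕ} (x : Fin N → Z) (ω : Fin N → Fin m → closedBall (0 : V) 1)
    (a : V) : randomMap x ω a = ∑ i, (∑ j, inner ℝ (ω i j : V) a) • x i := by
  simp [randomMap]

omit [FiniteDimensional ℝ V] in
theorem continuous_norm_randomMap {N m : ℕ} (x : Fin N → Z) (a : V) :
    Continuous fun ω : Fin N → Fin m → closedBall (0 : V) 1 => ‖randomMap x ω a‖ := by
  simp only [randomMap_apply]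
  fun_prop

section Measure

variable [MeasurableSpace V] [BorelSpace V] (μ : Measure (closedBall (0 : V) 1))
  [IsProbabilityMeasure μ]

/-- The law of a matrix of independent points. -/
noncomputable abbrev matrixLaw (N m : ℕ) : Measure (Fin N → Fin m → closedBall (0 : V) 1) :=
  Measure.pi fun _ => Measure.pi fun _ => μ

theorem variance_norm_randomMap_le {N m : ℕ} {x : Fin N → Z}
    (hx : ∀ a : Fin N → ℝ, ‖∑ i, a i • x i‖ ^ 2 ≤ ∑ i, a i ^ 2) (a : V) (ha : ‖a‖ = 1) :
    ∫ ω, (‖randomMap x ω a‖ - ∫ ω, ‖randomMap x ω a‖ ∂(matrixLaw μ N m)) ^ 2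
      ∂(matrixLaw μ N m) ≤ 4 * m := by
  refine variance_le_of_update_nested μ N m (continuous_norm_randomMap x a) _ fun ω => ?_
  obtain ⟨φ, hφ, hφv⟩ := exists_dual_vector'' ℝ (randomMap x ω a)
  refine ⟨fun i _ => 4 * φ (x i) ^ 2, ?_, fun i j b => ?_⟩
  · have := sum_sq_dual_le_one hx φ hφ
    simp only [Finset.sum_const, Finset.card_univ, Fintype.card_fin, nsmul_eq_mul]
    rw [← Finset.mul_sum, ← Finset.mul_sum]
    nlinarith [(Nat.cast_nonneg m : (0 : ℝ) ≤ m)]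
  · set ω' := Function.update ω i (Function.update (ω i) j b)
    have h1 : randomMap x ω a - randomMap x ω' a =
        (inner ℝ (ω i j : V) a - inner ℝ (b : V) a) • x i := by
      rw [randomMap_apply, randomMap_apply, ← Finset.sum_sub_distrib, Finset.sum_eq_single i]
      · rw [← sub_smul, ← Finset.sum_sub_distrib, Finset.sum_eq_single j]
        · simp [ω']
        · intro j' _ hj
          simp [ω', Function.update_of_ne hj]
        · simp
      · intro i' _ hi
        simp [ω', Function.update_of_ne hi]
      · simp
    have hin : ∀ b : closedBall (0 : V) 1, |inner ℝ (b : V) a| ≤ 1 := fun b => by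
      have hb : ‖(b : V)‖ ≤ 1 := mem_closedBall_zero_iff.mp b.2
      have := abs_real_inner_le_norm (b : V) a
      rw [ha, mul_one] at this
      exact this.trans hb
    have h2 : ‖randomMap x ω a‖ - ‖randomMap x ω' a‖ ≤ 2 * |φ (x i)| := by
      have h3 : φ (randomMap x ω' a) ≤ ‖randomMap x ω' a‖ :=
        (le_abs_self _).trans (φ.le_of_opNorm_le hφ _ |>.trans (by simp))
      have h4 : φ (randomMap x ω a) = ‖randomMap x ω a‖ := hφv
      calc _ ≤ φ (randomMap x ω a - randomMap x ω' a) := by rw [map_sub]; linarith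
        _ = (inner ℝ (ω i j : V) a - inner ℝ (b : V) a) * φ (x i) := by simp [h1]
        _ ≤ |inner ℝ (ω i j : V) a - inner ℝ (b : V) a| * |φ (x i)| := by
          rw [← abs_mul]; exact le_abs_self _
        _ ≤ 2 * |φ (x i)| := by
          gcongr
          have := abs_sub (inner ℝ (ω i j : V) a) (inner ℝ (b : V) a)
          linarith [hin (ω i j), hin b]
    calc _ ≤ (2 * |φ (x i)|) ^ 2 := by
          gcongr
          exact max_le h2 (by positivity)
      _ = _ := by rw [mul_pow, sq_abs]; norm_num

/-- The law is invariant under isometries acting on the rows. -/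
theorem measurePreserving_closedBallMap
    (hμ : ∀ T : V ≃ₗᵢ[ℝ] V, MeasurePreserving (closedBallMap T) μ μ) (N m : ℕ)
    (T : Fin N → V ≃ₗᵢ[ℝ] V) : MeasurePreserving
      (fun (ω : Fin N → Fin m → closedBall (0 : V) 1) i j => closedBallMap (T i) (ω i j))
      (matrixLaw μ N m) (matrixLaw μ N m) :=
  measurePreserving_pi _ _ fun i => measurePreserving_pi _ _ fun _ => hμ (T i)

theorem integral_comp_closedBallMap
    (hμ : ∀ T : V ≃ₗᵢ[ℝ] V, MeasurePreserving (closedBallMap T) μ μ) {N m : ℕ}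
    (T : Fin N → V ≃ₗᵢ[ℝ] V) (x : Fin N → Z) (a : V) :
    ∫ ω, ‖randomMap x (fun i j => closedBallMap (T i) (ω i j)) a‖ ∂(matrixLaw μ N m) =
      ∫ ω, ‖randomMap x ω a‖ ∂(matrixLaw μ N m) := by
  have h := measurePreserving_closedBallMap μ hμ N m T
  conv_rhs => rw [← h.map_eq]
  rw [integral_map h.measurable.aemeasurable
    (continuous_norm_randomMap x a).aestronglyMeasurable]

theorem integral_norm_randomMap_eq
    (hμ : ∀ T : V ≃ₗᵢ[ℝ] V, MeasurePreserving (closedBallMap T) μ μ) {N m : ℕ}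
    (x : Fin N → Z) {a b : V} (hab : ‖a‖ = ‖b‖) :
    ∫ ω, ‖randomMap x ω a‖ ∂(matrixLaw μ N m) = ∫ ω, ‖randomMap x ω b‖ ∂(matrixLaw μ N m) := by
  let T : V ≃ₗᵢ[ℝ] V := (ℝ ∙ (a - b))ᗮ.reflection
  have hT : T b = a := by
    rw [← Submodule.reflection_sub hab]; exact Submodule.reflection_reflection _ _
  have hTa : T a = b := Submodule.reflection_sub hab
  rw [← integral_comp_closedBallMap μ hμ (fun _ => T) x b]
  congr 1; ext ω
  rw [randomMap_apply, randomMap_apply]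
  congr 1
  refine Finset.sum_congr rfl fun i _ => ?_
  congr 1
  refine Finset.sum_congr rfl fun j _ => ?_
  change _ = inner ℝ (T (ω i j : V)) b
  rw [← hTa, T.inner_map_map]

theorem exists_integral_norm_randomMap_ge
    (hμ : ∀ T : V ≃ₗᵢ[ℝ] V, MeasurePreserving (closedBallMap T) μ μ) (e : V)
    (he : 0 < μ {b | 1 / 2 ≤ inner ℝ e (b : V)}) (m : ℕ) : ∃ N : ℕ, ∀ x : Fin N → Z,
      (∀ i, 1 / 4 ≤ ‖x i‖) → m / 16 ≤ ∫ ω, ‖randomMap x ω e‖ ∂(matrixLaw μ N m) := by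
  set A : Set (closedBall (0 : V) 1) := {b | 1 / 2 ≤ inner ℝ e (b : V)}
  have hA : MeasurableSet A := (isClosed_le continuous_const (by fun_prop)).measurableSet
  set R : Set (Fin m → closedBall (0 : V) 1) := Set.pi Set.univ fun _ => A
  have hR : MeasurableSet R := MeasurableSet.univ_pi fun _ => hA
  set ν : Measure (Fin m → closedBall (0 : V) 1) := Measure.pi fun _ => μ
  have hνR : 0 < ν.real R := by
    rw [measureReal_def, ENNReal.toReal_pos_iff]
    refine ⟨?_, measure_lt_top _ _⟩
    simp only [ν, R, Measure.pi_pi]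
    simp [pos_iff_ne_zero, he.ne']
  have hνR1 : ν.real Rᶜ < 1 := by
    rw [probReal_compl_eq_one_sub hR]; linarith
  obtain ⟨N, hN⟩ := exists_pow_lt_of_lt_one (show (0 : ℝ) < 1 / 2 by norm_num) hνR1
  refine ⟨N, fun x hx => ?_⟩
  set U : Set (Fin N → Fin m → closedBall (0 : V) 1) := Set.pi Set.univ fun _ => Rᶜ
  have hU : MeasurableSet U := MeasurableSet.univ_pi fun _ => hR.compl
  have hUm : (matrixLaw μ N m).real U = ν.real Rᶜ ^ N := by
    rw [measureReal_def, Measure.pi_pi]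
    simp [measureReal_def, ν]
  have hUc : 1 / 2 ≤ (matrixLaw μ N m).real Uᶜ := by
    rw [probReal_compl_eq_one_sub hU, hUm]; linarith
  let T : (Fin N → ℤˣ) → Fin N → V ≃ₗᵢ[ℝ] V := fun ε i =>
    if ε i = 1 then LinearIsometryEquiv.refl ℝ V else LinearIsometryEquiv.neg ℝ
  have hT : ∀ ε (ω : Fin N → Fin m → closedBall (0 : V) 1),
      randomMap x (fun i j => closedBallMap (T ε i) (ω i j)) e =
        ∑ i, ((ε i : ℤ) : ℝ) • (∑ j, inner ℝ (ω i j : V) e) • x i := fun ε ω => by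
    rw [randomMap_apply]
    refine Finset.sum_congr rfl fun i _ => ?_
    rcases Int.units_eq_one_or (ε i) with h | h <;> simp [T, h, closedBallMap]
  have hcont : ∀ ε, Continuous fun ω : Fin N → Fin m → closedBall (0 : V) 1 =>
      ‖randomMap x (fun i j => closedBallMap (T ε i) (ω i j)) e‖ := fun ε => by
    simp only [hT]; fun_prop
  have hpt : ∀ ω, Uᶜ.indicator (fun _ => (2 : ℝ) ^ N * (m / 8)) ω ≤
      ∑ ε, ‖randomMap x (fun i j => closedBallMap (T ε i) (ω i j)) e‖ := fun ω => by
    simp only [hT]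
    by_cases hω : ω ∈ Uᶜ
    · rw [Set.indicator_of_mem hω]
      obtain ⟨i, hi⟩ : ∃ i, ω i ∈ R := by
        simpa [U] using hω
      refine le_trans ?_ (sum_norm_signs_ge N _ i)
      gcongr
      have h1 : (m : ℝ) / 2 ≤ ∑ j, inner ℝ (ω i j : V) e := by
        have : ∑ _j : Fin m, (1 / 2 : ℝ) ≤ ∑ j, inner ℝ (ω i j : V) e :=
          Finset.sum_le_sum fun j _ => by
            rw [real_inner_comm]; exact hi j (Set.mem_univ j)
        simp at this
        linarith
      rw [norm_smul, Real.norm_eq_abs]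
      have h2 := h1.trans (le_abs_self _)
      have := mul_le_mul h2 (hx i) (by norm_num) (abs_nonneg _)
      linarith
    · rw [Set.indicator_of_notMem hω]
      positivity
  have hint := integral_mono (μ := matrixLaw μ N m)
    ((integrable_const _).indicator hU.compl)
    (integrable_of_continuous_of_compactSpace _ (continuous_finsetSum _ fun ε _ => hcont ε)) hpt
  rw [integral_finsetSum _ fun ε _ => integrable_of_continuous_of_compactSpace _ (hcont ε),
    integral_indicator_const _ hU.compl] at hint
  simp only [integral_comp_closedBallMap μ hμ] at hint
  simp only [Finset.sum_const, Finset.card_univ, Fintype.card_pi, Fintype.card_units_int,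
    Finset.prod_const, Fintype.card_fin, nsmul_eq_mul, smul_eq_mul] at hint
  push_cast at hint
  have hN2 : (0 : ℝ) < 2 ^ N := by positivity
  have h3 : (m : ℝ) / 8 * (1 / 2) ≤ (matrixLaw μ N m).real Uᶜ * (m / 8) := by
    rw [mul_comm]; gcongr
  have h4 : (matrixLaw μ N m).real Uᶜ * (m / 8) ≤
      ∫ ω, ‖randomMap x ω e‖ ∂(matrixLaw μ N m) := by
    refine le_of_mul_le_mul_left ?_ hN2
    linarith
  linarith

end Measure

theorem exists_almost_isometric_embedding (V : Type*) [NormedAddCommGroup V]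
    [InnerProductSpace ℝ V] [FiniteDimensional ℝ V] (hZ : ¬ FiniteDimensional ℝ Z) :
    ∃ J : V →L[ℝ] Z, ∀ a, ‖a‖ ≤ ‖J a‖ ∧ ‖J a‖ ≤ 2 * ‖a‖ := by
  classical
  rcases subsingleton_or_nontrivial V with hV | hV
  · exact ⟨0, fun a => by simp [Subsingleton.elim a 0]⟩
  let : MeasurableSpace V := borel V
  have : BorelSpace V := ⟨rfl⟩
  obtain ⟨μ, hμ, hμT, hμe⟩ := exists_invariant_measure (V := V)
  obtain ⟨net₀, hnet₀⟩ := exists_finset_net (V := V)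
  set net := net₀.filter fun y => ‖y‖ = 1
  obtain ⟨e, he⟩ : ∃ e : V, ‖e‖ = 1 := exists_norm_eq V zero_le_one
  have hnet : ∀ a : V, ‖a‖ = 1 → ∃ y ∈ net, ‖a - y‖ ≤ 1 / 8 := fun a ha => by
    obtain ⟨y, hy, hy1, hay⟩ := hnet₀ a ha
    exact ⟨y, Finset.mem_filter.mpr ⟨hy, hy1⟩, hay⟩
  have hcard : (1 : ℝ) ≤ net.card := by
    obtain ⟨y, hy, -⟩ := hnet e he
    exact_mod_cast Finset.card_pos.mpr ⟨y, hy⟩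
  set m : ℕ := 65536 * net.card with hm
  obtain ⟨N, hN⟩ := exists_integral_norm_randomMap_ge (Z := Z) μ hμT e (hμe e he) m
  obtain ⟨x, hx1, hx2⟩ := exists_dvoretzky_rogers hZ N
  set M : ℝ := ∫ ω, ‖randomMap x ω e‖ ∂(matrixLaw μ N m)
  have hM : 4096 * (net.card : ℝ) ≤ M := by
    have := hN x hx1
    rw [hm] at this
    push_cast at this
    linarith
  have hcont : ∀ a : V, Continuous fun ω : Fin N → Fin m → closedBall (0 : V) 1 =>
      (‖randomMap x ω a‖ - M) ^ 2 := fun a =>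
    ((continuous_norm_randomMap x a).sub continuous_const).pow 2
  have hsum : ∫ ω, ∑ a ∈ net, (‖randomMap x ω a‖ - M) ^ 2 ∂(matrixLaw μ N m) ≤
      net.card * (4 * m) := by
    rw [integral_finsetSum _ fun a _ => integrable_of_continuous_of_compactSpace _ (hcont a),
      ← nsmul_eq_mul]
    refine Finset.sum_le_card_nsmul _ _ _ fun a ha => ?_
    have ha1 : ‖a‖ = 1 := (Finset.mem_filter.mp ha).2
    have := variance_norm_randomMap_le μ hx2 (m := m) a ha1
    rwa [integral_norm_randomMap_eq μ hμT x (ha1.trans he.symm)] at this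
  obtain ⟨ω, hω⟩ := exists_le_integral (μ := matrixLaw μ N m)
    (integrable_of_continuous_of_compactSpace _
      (continuous_finsetSum net fun a _ => hcont a))
  have hω' : ∀ a ∈ net, |‖randomMap x ω a‖ - M| ≤ M / 8 := fun a ha => by
    have h1 := (Finset.single_le_sum (f := fun a => (‖randomMap x ω a‖ - M) ^ 2)
      (fun a _ => sq_nonneg _) ha).trans (hω.trans hsum)
    refine abs_le_of_sq_le_sq (h1.trans ?_) (by linarith)
    rw [hm]
    push_cast
    nlinarith
  have hM0 : 0 < M := by linarith
  clear_value M
  have hb := norm_bounds_of_net (randomMap x ω) net hnet hM0.le hω'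
  refine ⟨(7 / (5 * M)) • randomMap x ω, fun a => ?_⟩
  obtain ⟨h1, h2⟩ := hb a
  rw [smul_apply, norm_smul, Real.norm_of_nonneg (by positivity)]
  constructor
  · calc ‖a‖ = 7 / (5 * M) * (5 / 7 * M * ‖a‖) := by field_simp
      _ ≤ _ := by gcongr
  · calc _ ≤ 7 / (5 * M) * (9 / 7 * M * ‖a‖) := by gcongr
      _ = 9 / 5 * ‖a‖ := by field_simp
      _ ≤ _ := by gcongr; norm_num

end Dvoretzky

section Hilbertian

variable {X : Type*} [NormedAddCommGroup X] [NormedSpace ℝ X]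

/-- `E` embeds linearly into an inner product space with distortion at most `D`. -/
def HilbertianWith (E : Submodule ℝ X) (D : ℝ) : Prop :=
  ∃ (V : Type) (_ : NormedAddCommGroup V) (_ : InnerProductSpace ℝ V) (U : E →ₗ[ℝ] V),
    ∀ e, ‖e‖ ≤ ‖U e‖ ∧ ‖U e‖ ≤ D * ‖e‖

theorem HilbertianWith.exists_linearEquiv {E : Submodule ℝ X} [FiniteDimensional ℝ E] {D : ℝ}
    (h : HilbertianWith E D) :
    ∃ (V : Type) (_ : NormedAddCommGroup V) (_ : InnerProductSpace ℝ V) (U : E ≃ₗ[ℝ] V),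
      ∀ e, ‖e‖ ≤ ‖U e‖ ∧ ‖U e‖ ≤ D * ‖e‖ := by
  obtain ⟨V, _, _, U, hU⟩ := h
  have hinj : Function.Injective U := by
    rw [← LinearMap.ker_eq_bot, LinearMap.ker_eq_bot']
    intro e he
    have := (hU e).1
    rw [he, norm_zero] at this
    exact norm_le_zero_iff.mp this
  exact ⟨LinearMap.range U, inferInstance, inferInstance, LinearEquiv.ofInjective U hinj,
    fun e => by simpa using hU e⟩

theorem exists_hilbertianWith (E : Submodule ℝ X) [FiniteDimensional ℝ E] :
    ∃ D, 0 < D ∧ HilbertianWith E D := by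
  let U : E ≃L[ℝ] EuclideanSpace ℝ (Fin (Module.finrank ℝ E)) :=
    ContinuousLinearEquiv.ofFinrankEq (by simp)
  set A : ℝ := ‖(U.symm : EuclideanSpace ℝ (Fin (Module.finrank ℝ E)) →L[ℝ] E)‖
  set B : ℝ := ‖(U : E →L[ℝ] EuclideanSpace ℝ (Fin (Module.finrank ℝ E)))‖
  refine ⟨A * B + 1, by positivity, EuclideanSpace ℝ (Fin (Module.finrank ℝ E)),
    inferInstance, inferInstance, A • (U : E →ₗ[ℝ] _), fun e => ?_⟩
  have h1 : ‖e‖ ≤ A * ‖U e‖ := by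
    simpa using (U.symm : EuclideanSpace ℝ (Fin (Module.finrank ℝ E)) →L[ℝ] E).le_opNorm (U e)
  have h2 : ‖U e‖ ≤ B * ‖e‖ :=
    (U : E →L[ℝ] EuclideanSpace ℝ (Fin (Module.finrank ℝ E))).le_opNorm e
  have hA : 0 ≤ A := by positivity
  have h3 : ‖(A • (U : E →ₗ[ℝ] EuclideanSpace ℝ (Fin (Module.finrank ℝ E)))) e‖ = A * ‖U e‖ := by
    simp [norm_smul, abs_of_nonneg hA]
  rw [h3]
  refine ⟨h1, ?_⟩
  calc A * ‖U e‖ ≤ A * (B * ‖e‖) := by gcongr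
    _ ≤ _ := by nlinarith [norm_nonneg e]

theorem HilbertianWith.of_le {E F : Submodule ℝ X} {D : ℝ} (h : HilbertianWith F D)
    (hEF : E ≤ F) : HilbertianWith E D := by
  obtain ⟨V, _, _, U, hU⟩ := h
  exact ⟨V, inferInstance, inferInstance, U ∘ₗ Submodule.inclusion hEF,
    fun e => by simpa using hU (Submodule.inclusion hEF e)⟩

theorem HilbertianWith.mono {E : Submodule ℝ X} {D D' : ℝ} (h : HilbertianWith E D)
    (hD : D ≤ D') : HilbertianWith E D' := by
  obtain ⟨V, _, _, U, hU⟩ := h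
  exact ⟨V, inferInstance, inferInstance, U,
    fun e => ⟨(hU e).1, (hU e).2.trans (by gcongr)⟩⟩

/-- The factorisation behind the improvement of the distortion. -/
theorem exists_norm_le_add {E : Submodule ℝ X} [FiniteDimensional ℝ E] {lam : ℝ} (hlam : 0 ≤ lam)
    (hcomp : ∀ F : Submodule ℝ X, FiniteDimensional ℝ F → IsComplementedWith F lam)
    (hX : ¬ FiniteDimensional ℝ X) {V : Type*} [NormedAddCommGroup V] [InnerProductSpace ℝ V]
    (U : E ≃ₗ[ℝ] V) (hU : ∀ e, ‖e‖ ≤ ‖U e‖) {c : ℝ} (hc : 0 < c) :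
    ∃ α : X →ₗ[ℝ] V, (∀ x, ‖α x‖ ≤ (lam + lam ^ 2) * ‖x‖) ∧
      ∀ e : E, ‖e‖ ≤ c * ‖α e‖ + 2 * lam ^ 2 / c * ‖U e‖ := by
  have hV : FiniteDimensional ℝ V := U.finiteDimensional
  obtain ⟨P, hPn, hPm, hPe⟩ := hcomp E inferInstance
  have hZ : ¬ FiniteDimensional ℝ (LinearMap.ker P) := fun hfin => by
    have : FiniteDimensional ℝ (LinearMap.range P) :=
      Submodule.finiteDimensional_of_le (S₂ := E) (by rintro _ ⟨x, rfl⟩; exact hPm x)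
    have : FiniteDimensional ℝ (X ⧸ LinearMap.ker P) := P.quotKerEquivRange.symm.finiteDimensional
    exact hX (Module.Finite.of_submodule_quotient (LinearMap.ker P))
  obtain ⟨J, hJ⟩ := exists_almost_isometric_embedding V hZ
  let g : V →ₗ[ℝ] X := c • (E.subtype ∘ₗ (U.symm : V →ₗ[ℝ] E)) +
    (LinearMap.ker P).subtype ∘ₗ (J : V →ₗ[ℝ] LinearMap.ker P)
  have hg : ∀ a, g a = c • (U.symm a : X) + (J a : X) := fun a => rfl
  have hPg : ∀ a, P (g a) = c • (U.symm a : X) := fun a => by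
    have h0 : P (J a : X) = 0 := (J a).2
    rw [hg, map_add, map_smul, hPe _ (U.symm a).2, h0, add_zero]
  have hinj : Function.Injective g := by
    rw [← LinearMap.ker_eq_bot, LinearMap.ker_eq_bot']
    intro a ha
    have := hPg a
    rw [ha, map_zero, eq_comm, smul_eq_zero] at this
    simpa [hc.ne'] using this
  obtain ⟨Q, hQn, hQm, hQe⟩ := hcomp (LinearMap.range g) inferInstance
  let α : X →ₗ[ℝ] V := (LinearEquiv.ofInjective g hinj).symm ∘ₗ Q.codRestrict _ hQm
  have hα : ∀ x, g (α x) = Q x := fun x => by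
    have := (LinearEquiv.ofInjective g hinj).apply_symm_apply (Q.codRestrict _ hQm x)
    exact congrArg Subtype.val this
  have hαg : ∀ a, α (g a) = a := fun a => hinj <| by
    rw [hα, hQe _ ⟨a, rfl⟩]
  have h1 : ∀ x, c * ‖(U.symm (α x) : X)‖ ≤ lam ^ 2 * ‖x‖ := fun x => by
    calc c * ‖(U.symm (α x) : X)‖ = ‖P (Q x)‖ := by
          rw [← hα, hPg, norm_smul, Real.norm_of_nonneg hc.le]
      _ ≤ lam * (lam * ‖x‖) := (hPn _).trans (by gcongr; exact hQn x)
      _ = _ := by ring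
  have h2 : ∀ x, ‖α x‖ ≤ (lam + lam ^ 2) * ‖x‖ := fun x => by
    calc ‖α x‖ ≤ ‖(J (α x) : X)‖ := (hJ _).1
      _ = ‖Q x - c • (U.symm (α x) : X)‖ := by rw [← hα, hg, add_sub_cancel_left]
      _ ≤ ‖Q x‖ + ‖c • (U.symm (α x) : X)‖ := norm_sub_le _ _
      _ ≤ lam * ‖x‖ + lam ^ 2 * ‖x‖ := by
        rw [norm_smul, Real.norm_of_nonneg hc.le]
        exact add_le_add (hQn x) (h1 x)
      _ = _ := by ring
  refine ⟨α, h2, fun e => ?_⟩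
  have h3 : c • α e + α (J (U e)) = U e := by
    rw [← map_smul, ← map_add]
    simpa [hg] using hαg (U e)
  have h4 : e = c • U.symm (α e) + U.symm (α (J (U e))) := by
    rw [← map_smul, ← map_add, h3, U.symm_apply_apply]
  have h5 : ‖U.symm (α e)‖ ≤ ‖α e‖ := by simpa using hU (U.symm (α e))
  have h6 : ‖U.symm (α (J (U e)))‖ ≤ 2 * lam ^ 2 / c * ‖U e‖ := by
    rw [div_mul_eq_mul_div, le_div_iff₀ hc, mul_comm]
    calc c * ‖U.symm (α (J (U e)))‖ ≤ lam ^ 2 * ‖(J (U e) : X)‖ := h1 _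
      _ ≤ lam ^ 2 * (2 * ‖U e‖) := by gcongr; exact (hJ _).2
      _ = _ := by ring
  calc ‖e‖ ≤ ‖c • U.symm (α e)‖ + ‖U.symm (α (J (U e)))‖ := by
        conv_lhs => rw [h4]
        exact norm_add_le _ _
    _ ≤ _ := by
      rw [norm_smul, Real.norm_of_nonneg hc.le]
      gcongr

theorem HilbertianWith.improve {E : Submodule ℝ X} [FiniteDimensional ℝ E] {lam : ℝ}
    (hlam : 0 ≤ lam)
    (hcomp : ∀ F : Submodule ℝ X, FiniteDimensional ℝ F → IsComplementedWith F lam)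
    (hX : ¬ FiniteDimensional ℝ X) {D : ℝ} (hD : 0 < D) (h : HilbertianWith E D) :
    HilbertianWith E √(2 * ((lam + lam ^ 2) ^ 2 + 4 * lam ^ 4) * D) := by
  obtain ⟨V, _, _, U, hU⟩ := h.exists_linearEquiv
  set c := √D
  have hc : 0 < c := Real.sqrt_pos.mpr hD
  have hcD : c ^ 2 = D := Real.sq_sqrt hD.le
  obtain ⟨α, hα, hle⟩ := exists_norm_le_add hlam hcomp hX U (fun e => (hU e).1) hc
  let U' : E →ₗ[ℝ] WithLp 2 (V × V) := (WithLp.linearEquiv 2 ℝ (V × V)).symm ∘ₗ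
    ((√2 * c) • (α ∘ₗ E.subtype)).prod ((√2 * (2 * lam ^ 2 / c)) • (U : E →ₗ[ℝ] V))
  have hU' : ∀ e, ‖U' e‖ ^ 2 = 2 * (c * ‖α e‖) ^ 2 + 2 * (2 * lam ^ 2 / c * ‖U e‖) ^ 2 :=
      fun e => by
    rw [WithLp.prod_norm_sq_eq_of_L2]
    have h1 : (U' e).fst = (√2 * c) • α e := rfl
    have h2 : (U' e).snd = (√2 * (2 * lam ^ 2 / c)) • U e := rfl
    rw [h1, h2, norm_smul, norm_smul, Real.norm_of_nonneg (by positivity),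
      Real.norm_of_nonneg (by positivity)]
    simp only [mul_pow]
    rw [Real.sq_sqrt (by norm_num)]
    ring
  refine ⟨WithLp 2 (V × V), inferInstance, inferInstance, U', fun e => ⟨?_, ?_⟩⟩
  · refine le_of_sq_le_sq ?_ (norm_nonneg _)
    rw [hU']
    refine (pow_le_pow_left₀ (norm_nonneg e) (hle e) 2).trans ?_
    nlinarith [sq_nonneg (c * ‖α e‖ - 2 * lam ^ 2 / c * ‖U e‖)]
  · refine le_of_sq_le_sq ?_ (by positivity)
    rw [hU', mul_pow _ ‖e‖, Real.sq_sqrt (by positivity)]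
    have h1 : (c * ‖α e‖) ^ 2 ≤ D * ((lam + lam ^ 2) ^ 2 * ‖e‖ ^ 2) := by
      rw [mul_pow, hcD, ← mul_pow]
      gcongr
      exact hα e
    have h2 : (2 * lam ^ 2 / c * ‖U e‖) ^ 2 ≤ 4 * lam ^ 4 * D * ‖e‖ ^ 2 := by
      calc (2 * lam ^ 2 / c * ‖U e‖) ^ 2 ≤ (2 * lam ^ 2 / c * (D * ‖e‖)) ^ 2 := by
            gcongr; exact (hU e).2
        _ = 4 * lam ^ 4 * (D ^ 2 / c ^ 2) * ‖e‖ ^ 2 := by ring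
        _ = _ := by rw [hcD]; field_simp
    linarith

theorem exists_uniform_hilbertianWith (h : UniformlyComplemented (⊤ : Submodule ℝ X)) :
    ∃ D, 0 < D ∧ ∀ E : Submodule ℝ X, FiniteDimensional ℝ E → HilbertianWith E D := by
  by_cases hX : FiniteDimensional ℝ X
  · obtain ⟨D, hD, h⟩ := exists_hilbertianWith (⊤ : Submodule ℝ X)
    exact ⟨D, hD, fun E _ => h.of_le le_top⟩
  obtain ⟨c, hc⟩ := h
  have hcomp : ∀ F : Submodule ℝ X, FiniteDimensional ℝ F → IsComplementedWith F |c| :=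
    fun F hF => (hc F le_top hF).mono (le_abs_self c)
  set κ : ℝ := 2 * ((|c| + |c| ^ 2) ^ 2 + 4 * |c| ^ 4)
  have hκ : 0 ≤ κ := by positivity
  refine ⟨κ + 1, by positivity, fun E hE => ?_⟩
  set S : Set ℝ := {D | 0 < D ∧ HilbertianWith E D}
  have hSne : S.Nonempty := exists_hilbertianWith E
  have hSb : BddBelow S := ⟨0, fun D hD => hD.1.le⟩
  have hS0 : 0 ≤ sInf S := le_csInf hSne fun D hD => hD.1.le
  have hstep : ∀ D ∈ S, ∀ η > 0, sInf S ^ 2 ≤ κ * D + η := fun D hD η hη => by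
    have h1 : HilbertianWith E √(κ * D + η) :=
      (hD.2.improve (abs_nonneg c) hcomp hX hD.1).mono
        (Real.sqrt_le_sqrt (le_add_of_nonneg_right hη.le))
    have hpos : 0 < κ * D + η := by have := hD.1; positivity
    have h2 : sInf S ≤ √(κ * D + η) := csInf_le hSb ⟨Real.sqrt_pos.mpr hpos, h1⟩
    calc sInf S ^ 2 ≤ √(κ * D + η) ^ 2 := by gcongr
      _ = _ := Real.sq_sqrt hpos.le
  have hinf : sInf S ≤ κ := by
    by_contra! hlt
    set t := sInf S
    have ht : 0 < t * (t - κ) := mul_pos (hκ.trans_lt hlt) (by linarith)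
    obtain ⟨D, hD, hDlt⟩ := exists_lt_of_csInf_lt hSne
      (lt_add_of_pos_right t (show 0 < t * (t - κ) / (4 * (κ + 1)) by positivity))
    have h1 := hstep D hD (t * (t - κ) / 4) (by positivity)
    have h2 : κ * (t * (t - κ) / (4 * (κ + 1))) ≤ t * (t - κ) / 4 := by
      rw [mul_div_assoc', div_le_div_iff₀ (by positivity) (by norm_num)]
      nlinarith
    have h3 : κ * D ≤ κ * t + t * (t - κ) / 4 := by
      refine (mul_le_mul_of_nonneg_left hDlt.le hκ).trans ?_
      rw [mul_add]
      linarith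
    nlinarith
  obtain ⟨D, hD, hDlt⟩ := exists_lt_of_csInf_lt hSne (hinf.trans_lt (lt_add_one κ))
  exact hD.2.mono hDlt.le

end Hilbertian

section Globalize

variable {X : Type*} [NormedAddCommGroup X] [NormedSpace ℝ X]

theorem exists_form_of_hilbertianWith {D : ℝ}
    (h : ∀ E : Submodule ℝ X, FiniteDimensional ℝ E → HilbertianWith E D) :
    ∃ b : X → X → ℝ, (∀ x y, b x y = b y x) ∧ (∀ x y z, b (x + y) z = b x z + b y z) ∧
      (∀ (r : ℝ) x y, b (r • x) y = r * b x y) ∧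
      ∀ x, ‖x‖ ^ 2 ≤ b x x ∧ b x x ≤ (D * ‖x‖) ^ 2 := by
  classical
  let span (s : Finset X) : Submodule ℝ X := Submodule.span ℝ (s : Set X)
  choose V iV jV U hU using fun s : Finset X => h (span s) inferInstance
  choose U' hU' using fun s => (U s).exists_extend
  let 𝒰 : Ultrafilter (Finset X) := Ultrafilter.of Filter.atTop
  have hev : ∀ x, ∀ᶠ s in (𝒰 : Filter (Finset X)), ‖x‖ ≤ ‖U' s x‖ ∧ ‖U' s x‖ ≤ D * ‖x‖ :=
      fun x => by
    refine (Filter.eventually_ge_atTop {x}).filter_mono (Ultrafilter.of_le _) |>.mono fun s hs => ?_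
    have hx : x ∈ span s := Submodule.subset_span (by simpa using hs)
    have : U' s x = U s ⟨x, hx⟩ := LinearMap.congr_fun (hU' s) ⟨x, hx⟩
    rw [this]
    exact hU s ⟨x, hx⟩
  have hlim : ∀ x y, ∃ l : ℝ, Filter.Tendsto (fun s => inner ℝ (U' s x) (U' s y)) 𝒰 (nhds l) :=
      fun x y => by
    set C := D * ‖x‖ * (D * ‖y‖)
    have hK : ↑(𝒰.map fun s => inner ℝ (U' s x) (U' s y)) ≤
        Filter.principal (Set.Icc (-C) C) := by
      rw [Filter.le_principal_iff]
      change ∀ᶠ s in (𝒰 : Filter (Finset X)), inner ℝ (U' s x) (U' s y) ∈ Set.Icc (-C) C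
      filter_upwards [hev x, hev y] with s hx hy
      rw [Set.mem_Icc, ← abs_le]
      exact (abs_real_inner_le_norm _ _).trans
        (mul_le_mul hx.2 hy.2 (norm_nonneg _) ((norm_nonneg _).trans hx.2))
    obtain ⟨l, -, hl⟩ := isCompact_Icc.ultrafilter_le_nhds _ hK
    exact ⟨l, hl⟩
  choose b hb using hlim
  refine ⟨b, fun x y => ?_, fun x y z => ?_, fun r x y => ?_, fun x => ⟨?_, ?_⟩⟩
  · exact tendsto_nhds_unique (hb x y) (by simpa only [real_inner_comm] using hb y x)
  · exact tendsto_nhds_unique (hb _ z) (by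
      simpa only [map_add, inner_add_left] using (hb x z).add (hb y z))
  · exact tendsto_nhds_unique (hb _ y) (by
      simpa only [map_smul, real_inner_smul_left] using (hb x y).const_mul r)
  · refine ge_of_tendsto (hb x x) ((hev x).mono fun s hs => ?_)
    rw [real_inner_self_eq_norm_sq]
    gcongr
    exact hs.1
  · refine le_of_tendsto (hb x x) ((hev x).mono fun s hs => ?_)
    rw [real_inner_self_eq_norm_sq]
    gcongr
    exact hs.2

end Globalize

theorem nonempty_hilbertIso_of_form {X : Type u} [NormedAddCommGroup X] [NormedSpace ℝ X]
    [CompleteSpace X] {D : ℝ} {b : X → X → ℝ} (hsymm : ∀ x y, b x y = b y x)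
    (hadd : ∀ x y z, b (x + y) z = b x z + b y z) (hsmul : ∀ (r : ℝ) x y, b (r • x) y = r * b x y)
    (hb : ∀ x, ‖x‖ ^ 2 ≤ b x x ∧ b x x ≤ (D * ‖x‖) ^ 2) : Nonempty (HilbertIso X) := by
  let core : InnerProductSpace.Core ℝ X :=
    { inner := b
      conj_inner_symm := fun x y => by simpa using hsymm y x
      re_inner_nonneg := fun x => by simpa using (sq_nonneg _).trans (hb x).1
      add_left := hadd
      smul_left := fun x y r => by simpa using hsmul r x y
      definite := fun x hx => by
        have := (hb x).1
        rw [show b x x = 0 from hx] at this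
        simpa using this }
  obtain ⟨H, iN, iI, e, he⟩ : ∃ (H : Type u) (_ : NormedAddCommGroup H)
      (_ : InnerProductSpace ℝ H) (e : X ≃ₗ[ℝ] H), ∀ x, ‖e x‖ = √(b x x) :=
    ⟨X, core.toNormedAddCommGroup, InnerProductSpace.ofCore core.toCore, LinearEquiv.refl ℝ X,
      fun x => rfl⟩
  let e' : X ≃L[ℝ] H := e.toContinuousLinearEquivOfBounds |D| 1
    (fun x => by
      rw [he]
      refine Real.sqrt_le_iff.mpr ⟨by positivity, (hb x).2.trans (le_of_eq ?_)⟩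
      rw [mul_pow, mul_pow, sq_abs])
    (fun y => by
      have h1 := he (e.symm y)
      rw [e.apply_symm_apply] at h1
      rw [one_mul, h1]
      exact Real.le_sqrt_of_sq_le (hb _).1)
  have : CompleteSpace H := (completeSpace_congr (e := e'.toEquiv) e'.isUniformEmbedding).1 inferInstance
  exact ⟨{ H := H, equiv := e' }⟩

theorem exists_lipschitz_retract_of_hilbert {H : Type*} [NormedAddCommGroup H]
    [InnerProductSpace ℝ H] {K : Set H} (hne : K.Nonempty) (hconv : Convex ℝ K)
    (hK : IsComplete K) : ∃ R : H → H, LipschitzWith 1 R ∧ (∀ x, R x ∈ K) ∧ ∀ k ∈ K, R k = k := by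
  choose R hRK hR using fun u => exists_norm_eq_iInf_of_complete_convex hne hK hconv u
  have hin : ∀ u, ∀ w ∈ K, inner ℝ (u - R u) (w - R u) ≤ 0 := fun u =>
    (norm_eq_iInf_iff_real_inner_le_zero hconv (hRK u)).mp (hR u)
  refine ⟨R, LipschitzWith.of_dist_le_mul fun u v => ?_, hRK, fun k hk => ?_⟩
  · rw [NNReal.coe_one, one_mul, dist_eq_norm, dist_eq_norm]
    have h1 := hin u (R v) (hRK v)
    have h2 := hin v (R u) (hRK u)
    have h3 : ‖R u - R v‖ ^ 2 ≤ inner ℝ (u - v) (R u - R v) := by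
      rw [← real_inner_self_eq_norm_sq]
      simp only [inner_sub_left, inner_sub_right] at h1 h2 ⊢
      linarith
    have h4 := h3.trans (real_inner_le_norm _ _)
    by_contra! h
    nlinarith [norm_nonneg (u - v)]
  · have := hin k k hk
    rw [real_inner_self_eq_norm_sq] at this
    have h0 : ‖k - R k‖ = 0 := by nlinarith [norm_nonneg (k - R k)]
    exact (sub_eq_zero.mp (norm_eq_zero.mp h0)).symm

/-- A real Banach space `X` is isomorphic to a Hilbert space if and only if
every (nonempty) convex compact subset `K ⊆ X` is a Lipschitz retract of `X`. -/
theorem isomorphic_to_hilbert_iff_every_convex_compact_is_lipschitz_retract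
    (X : Type u) [NormedAddCommGroup X] [NormedSpace ℝ X] [CompleteSpace X] :
    Nonempty (HilbertIso X) ↔
      ∀ K : Set X, K.Nonempty → Convex ℝ K → IsCompact K →
        ∃ (L : NNReal) (R : X → X), LipschitzWith L R ∧ (∀ x, R x ∈ K) ∧
          ∀ k ∈ K, R k = k := by
  constructor
  · rintro ⟨H, e⟩ K hne hconv hK
    obtain ⟨R, hL, hRK, hR⟩ := exists_lipschitz_retract_of_hilbert (hne.image e)
      (hconv.linear_image (e : X →ₗ[ℝ] H)) (hK.image e.continuous).isComplete
    refine ⟨_, e.symm ∘ R ∘ e, e.symm.lipschitz.comp (hL.comp e.lipschitz), fun x => ?_,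
      fun k hk => ?_⟩
    · obtain ⟨k, hk, hke⟩ := hRK (e x)
      simpa [← hke] using hk
    · simp [hR _ (Set.mem_image_of_mem e hk)]
  · intro h
    obtain ⟨D, -, hD⟩ := exists_uniform_hilbertianWith
      (uniformlyComplemented_of_lipschitz_retracts h)
    obtain ⟨b, hsymm, hadd, hsmul, hb⟩ := exists_form_of_hilbertianWith hD
    exact nonempty_hilbertIso_of_form hsymm hadd hsmul hb
end

section
/- Let X be a real Banach space which is uniformly rotund in the direction z, where z ∈ X and z ≠ 0. If (v_n) and (w_n) are sequences in the unit sphere S_X with v_n − w_n → z in norm, then there exist sequences (ṽ_n), (w̃_n) in S_X and real numbers (λ_n) such that ‖v_n − ṽ_n‖ → 0, ‖w_n − w̃_n‖ → 0, and ṽ_n − w̃_n = λ_n z for every n. -/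
open Filter

/-- A normed space `X` is uniformly rotund in the direction `z` if for all sequences
`(x n)`, `(y n)` in the unit sphere with `‖(x n + y n)/2‖ → 1` and `x n - y n = r n • z`,
one has `‖x n - y n‖ → 0`. -/
def UniformlyRotundInDirection (X : Type*) [NormedAddCommGroup X] [NormedSpace ℝ X]
    (z : X) : Prop :=
  ∀ (x y : ℕ → X) (r : ℕ → ℝ),
    (∀ n, ‖x n‖ = 1) → (∀ n, ‖y n‖ = 1) →
    Tendsto (fun n => ‖(2 : ℝ)⁻¹ • (x n + y n)‖) atTop (nhds 1) →
    (∀ n, x n - y n = r n • z) →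
    Tendsto (fun n => ‖x n - y n‖) atTop (nhds 0)

/-- The sequential definition of directional uniform rotundity gives a modulus: chords of the unit
sphere in the direction `z` of length at least `c` have uniformly deep midpoints. -/
theorem UniformlyRotundInDirection.exists_modulus {X : Type*} [NormedAddCommGroup X]
    [NormedSpace ℝ X] {z : X} (h : UniformlyRotundInDirection X z) {c : ℝ} (hc : 0 < c) :
    ∃ δ > 0, ∀ (x y : X) (r : ℝ), ‖x‖ = 1 → ‖y‖ = 1 → x - y = r • z → c ≤ ‖x - y‖ →
      ‖(2 : ℝ)⁻¹ • (x + y)‖ ≤ 1 - δ := by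
  by_contra! hcon
  choose x y r hx hy hxy hxyc hmid using
    fun n : ℕ => hcon (1 / ((n : ℝ) + 1)) Nat.one_div_pos_of_nat
  have hlim : Tendsto (fun n => ‖(2 : ℝ)⁻¹ • (x n + y n)‖) atTop (nhds 1) := by
    refine tendsto_of_tendsto_of_tendsto_of_le_of_le
      (g := fun n : ℕ => 1 - 1 / ((n : ℝ) + 1)) ?_ tendsto_const_nhds
      (fun n => (hmid n).le) (fun n => ?_)
    · simpa using tendsto_const_nhds.sub (tendsto_one_div_add_atTop_nhds_zero_nat (𝕜 := ℝ))
    · have := norm_add_le (x n) (y n)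
      rw [hx, hy] at this
      change ‖(2 : ℝ)⁻¹ • (x n + y n)‖ ≤ 1
      rw [norm_smul, Real.norm_of_nonneg (by norm_num)]
      linarith
  exact hc.not_ge (ge_of_tendsto' (h x y r hx hy hlim hxy) hxyc)

/-- A ray from a point `p` of the unit sphere through a distinct point `q` of the unit ball meets
the sphere at or beyond `q`. -/
theorem exists_one_le_norm_add_smul_sub_eq_one {X : Type*} [NormedAddCommGroup X]
    [NormedSpace ℝ X] {p q : X} (hp : ‖p‖ = 1) (hq : ‖q‖ ≤ 1) (hpq : p ≠ q) :
    ∃ t : ℝ, 1 ≤ t ∧ ‖p + t • (q - p)‖ = 1 := by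
  have hpos : 0 < ‖q - p‖ := norm_pos_iff.2 (sub_ne_zero.2 hpq.symm)
  have hle : ‖q - p‖ ≤ 2 := (norm_sub_le q p).trans (by linarith)
  have hT : 1 ≤ 2 / ‖q - p‖ := (one_le_div hpos).2 hle
  have hcont : ContinuousOn (fun t : ℝ => ‖p + t • (q - p)‖) (Set.Icc 1 (2 / ‖q - p‖)) := by
    fun_prop
  have hend : 1 ≤ ‖p + (2 / ‖q - p‖) • (q - p)‖ := by
    have h1 := norm_sub_le (p + (2 / ‖q - p‖) • (q - p)) p
    rw [add_sub_cancel_left, norm_smul, Real.norm_of_nonneg (by positivity),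
      div_mul_cancel₀ _ hpos.ne', hp] at h1
    linarith
  obtain ⟨t, ht, h⟩ := intermediate_value_Icc hT hcont
    (show (1 : ℝ) ∈ Set.Icc _ _ from ⟨by simpa using hq, hend⟩)
  exact ⟨t, ht.1, h⟩

/-- In a direction of uniform rotundity, a point `q` of the unit ball which is close to the sphere
and at distance at least `c` from a point `p` of the sphere can be moved to the sphere along the
line through `p` and `q`, at a cost linear in `1 - ‖q‖`. -/
theorem UniformlyRotundInDirection.exists_near_mem_sphere {X : Type*} [NormedAddCommGroup X]
    [NormedSpace ℝ X] {z : X} (h : UniformlyRotundInDirection X z) {c : ℝ} (hc : 0 < c) :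
    ∃ K > 0, ∃ η > 0, ∀ (p q : X) (r : ℝ), ‖p‖ = 1 → ‖q‖ ≤ 1 → p - q = r • z → c ≤ ‖p - q‖ →
      1 - ‖q‖ < η → ∃ (y : X) (s : ℝ), ‖y‖ = 1 ∧ p - y = s • z ∧ ‖q - y‖ ≤ K * (1 - ‖q‖) := by
  obtain ⟨δ, hδ, hmod⟩ := h.exists_modulus hc
  refine ⟨2 / δ, by positivity, c * δ, by positivity, fun p q r hp hq hpq hcpq hη => ?_⟩
  have hne : p ≠ q := by
    rintro rfl
    simp only [sub_self, norm_zero] at hcpq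
    linarith
  obtain ⟨t, ht, hy⟩ := exists_one_le_norm_add_smul_sub_eq_one hp hq hne
  set y := p + t • (q - p) with hydef
  have ht0 : 0 < t := by linarith
  have hpy' : p - y = t • (p - q) := by rw [hydef]; module
  have hpy : p - y = (t * r) • z := by rw [hpy', hpq, smul_smul]
  have hnpy : ‖p - y‖ = t * ‖p - q‖ := by rw [hpy', norm_smul, Real.norm_of_nonneg ht0.le]
  have hmid := hmod p y (t * r) hp hy hpy (by rw [hnpy]; nlinarith)
  set m := (2 : ℝ)⁻¹ • (p + y) with hmdef
  have htc : t * c ≤ 2 := by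
    have := norm_sub_le p y
    rw [hp, hy, hnpy] at this
    nlinarith
  have hqy : ‖q - y‖ ≤ 2 * (t - 1) := by
    have h1 : q - y = (t - 1) • (p - q) := by rw [hydef]; module
    have h2 := norm_sub_le p q
    rw [h1, norm_smul, Real.norm_of_nonneg (by linarith)]
    nlinarith
  refine ⟨y, t * r, hy, hpy, ?_⟩
  rcases le_total t 2 with ht2 | ht2
  · have hcomb : t • q = (2 * (t - 1)) • m + (2 - t) • y := by
      rw [hmdef, hydef]; module
    clear_value m y
    have h1 := norm_add_le ((2 * (t - 1)) • m) ((2 - t) • y)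
    rw [← hcomb, norm_smul, norm_smul, norm_smul, Real.norm_of_nonneg ht0.le,
      Real.norm_of_nonneg (by linarith : 0 ≤ 2 * (t - 1)),
      Real.norm_of_nonneg (by linarith : 0 ≤ 2 - t), hy] at h1
    have h2 : 2 * (t - 1) * ‖m‖ ≤ 2 * (t - 1) * (1 - δ) := by gcongr
    have h3 : 2 * (t - 1) * δ ≤ 2 * (1 - ‖q‖) := by nlinarith
    rw [div_mul_eq_mul_div, le_div_iff₀ hδ]
    nlinarith
  · have hcomb : t • q = (t - 2) • p + (2 : ℝ) • m := by
      rw [hmdef, hydef]; module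
    clear_value m y
    have h1 := norm_add_le ((t - 2) • p) ((2 : ℝ) • m)
    rw [← hcomb, norm_smul, norm_smul, norm_smul, Real.norm_of_nonneg ht0.le,
      Real.norm_of_nonneg (by linarith : 0 ≤ t - 2),
      Real.norm_of_nonneg (by norm_num : (0 : ℝ) ≤ 2), hp] at h1
    have h3 : t * (1 - ‖q‖) < t * (c * δ) := by gcongr
    nlinarith

/-- Two points of the unit sphere whose difference is at small distance `e` from `z` can be moved
within the sphere, at a cost linear in `e`, so that their difference becomes parallel to `z`. -/
theorem UniformlyRotundInDirection.exists_parallel_near {X : Type*} [NormedAddCommGroup X]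
    [NormedSpace ℝ X] {z : X} (h : UniformlyRotundInDirection X z) (hz : z ≠ 0) :
    ∃ C : ℝ, ∃ η > 0, ∀ v w : X, ‖v‖ = 1 → ‖w‖ = 1 → ‖v - w - z‖ < η →
      ∃ (x y : X) (r : ℝ), ‖x‖ = 1 ∧ ‖y‖ = 1 ∧ x - y = r • z ∧
        ‖v - x‖ ≤ C * ‖v - w - z‖ ∧ ‖w - y‖ ≤ C * ‖v - w - z‖ := by
  have hz0 : 0 < ‖z‖ := norm_pos_iff.2 hz
  obtain ⟨K, hK, η, hη, hnear⟩ := h.exists_near_mem_sphere (half_pos hz0)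
  refine ⟨K + 2, min η 1, by positivity, fun v w hv hw he => ?_⟩
  obtain ⟨heη, he1⟩ := lt_min_iff.1 he
  have hvq : v - (w + z) = v - w - z := by abel
  set e := ‖v - w - z‖ with hedef
  have he0 : 0 ≤ e := norm_nonneg _
  have habs := abs_norm_sub_norm_le v (w + z)
  rw [hvq, hv, ← hedef, abs_le] at habs
  set ρ := ‖w + z‖ with hρ
  rcases le_total ρ 1 with h1 | h1
  · obtain ⟨y, s, hy, hwy, hqy⟩ := hnear w (w + z) (-1) hw h1 (by module)
      (by rw [sub_add_cancel_left, norm_neg]; linarith) (by linarith)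
    refine ⟨y, w, -s, hy, hw, by rw [neg_smul, ← hwy]; abel, ?_, ?_⟩
    · have h2 := norm_sub_le_norm_sub_add_norm_sub v (w + z) y
      rw [hvq, ← hedef] at h2
      nlinarith
    · rw [sub_self, norm_zero]; positivity
  · have hρ0 : 0 < ρ := by linarith
    have hinv : ρ * ρ⁻¹ = 1 := mul_inv_cancel₀ hρ0.ne'
    have hi0 : 0 < ρ⁻¹ := inv_pos.2 hρ0
    have hi1 : ρ⁻¹ ≤ 1 := inv_le_one_of_one_le₀ h1
    have hie : 1 - ρ⁻¹ ≤ e := by nlinarith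
    have hnp : ‖ρ⁻¹ • (w + z)‖ = 1 := by
      rw [norm_smul, Real.norm_of_nonneg hi0.le, ← hρ, mul_comm, hinv]
    have hnq : ‖ρ⁻¹ • w‖ = ρ⁻¹ := by rw [norm_smul, Real.norm_of_nonneg hi0.le, hw, mul_one]
    have hdiff : ρ⁻¹ • (w + z) - ρ⁻¹ • w = ρ⁻¹ • z := by module
    obtain ⟨y, s, hy, hpy, hqy⟩ := hnear (ρ⁻¹ • (w + z)) (ρ⁻¹ • w) ρ⁻¹ hnp (by rwa [hnq]) hdiff
      (by
        rw [hdiff, norm_smul, Real.norm_of_nonneg hi0.le]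
        have : 1 / 2 ≤ ρ⁻¹ := by nlinarith
        nlinarith)
      (by rw [hnq]; linarith)
    rw [hnq] at hqy
    refine ⟨ρ⁻¹ • (w + z), y, s, hnp, hy, hpy, ?_, ?_⟩
    · have h2 := norm_sub_le_norm_sub_add_norm_sub v (w + z) (ρ⁻¹ • (w + z))
      have h3 : w + z - ρ⁻¹ • (w + z) = (1 - ρ⁻¹) • (w + z) := by module
      rw [hvq, h3, norm_smul, Real.norm_of_nonneg (by linarith), ← hedef, ← hρ] at h2
      nlinarith
    · have h2 := norm_sub_le_norm_sub_add_norm_sub w (ρ⁻¹ • w) y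
      have h3 : w - ρ⁻¹ • w = (1 - ρ⁻¹) • w := by module
      rw [h3, norm_smul, Real.norm_of_nonneg (by linarith), hw] at h2
      nlinarith

/-- Let `X` be a real Banach space uniformly rotund in the direction
`z ≠ 0`. If `(v n)` and `(w n)` are sequences in the unit sphere with `v n - w n → z`,
then there are sequences `(ṽ n)`, `(w̃ n)` in the unit sphere and reals `(λ n)` with
`‖v n - ṽ n‖ → 0`, `‖w n - w̃ n‖ → 0` and `ṽ n - w̃ n = λ n • z` for every `n`. -/
theorem align_sequences_with_direction_of_uniform_rotundity
    {X : Type*} [NormedAddCommGroup X] [NormedSpace ℝ X] [CompleteSpace X]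
    (z : X) (hz : z ≠ 0) (hured : UniformlyRotundInDirection X z)
    (v w : ℕ → X) (hv : ∀ n, ‖v n‖ = 1) (hw : ∀ n, ‖w n‖ = 1)
    (hconv : Tendsto (fun n => v n - w n) atTop (nhds z)) :
    ∃ (vt wt : ℕ → X) (lam : ℕ → ℝ),
      (∀ n, ‖vt n‖ = 1) ∧ (∀ n, ‖wt n‖ = 1) ∧
      Tendsto (fun n => ‖v n - vt n‖) atTop (nhds 0) ∧
      Tendsto (fun n => ‖w n - wt n‖) atTop (nhds 0) ∧
      ∀ n, vt n - wt n = lam n • z := by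
  obtain ⟨C, η, hη, hpar⟩ := hured.exists_parallel_near hz
  have he : Tendsto (fun n => ‖v n - w n - z‖) atTop (nhds 0) :=
    tendsto_iff_norm_sub_tendsto_zero.1 hconv
  have hall : ∀ n, ∃ (x y : X) (r : ℝ), ‖x‖ = 1 ∧ ‖y‖ = 1 ∧ x - y = r • z ∧
      (‖v n - w n - z‖ < η →
        ‖v n - x‖ ≤ C * ‖v n - w n - z‖ ∧ ‖w n - y‖ ≤ C * ‖v n - w n - z‖) := by
    intro n
    by_cases hn : ‖v n - w n - z‖ < η
    · obtain ⟨x, y, r, hx, hy, hxy, hb⟩ := hpar (v n) (w n) (hv n) (hw n) hn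
      exact ⟨x, y, r, hx, hy, hxy, fun _ => hb⟩
    · exact ⟨v n, v n, 0, hv n, hv n, by simp, fun h => absurd h hn⟩
  choose x y r hx hy hxy hb using hall
  have hsmall : ∀ᶠ n in atTop, ‖v n - w n - z‖ < η := he.eventually_lt_const hη
  have hCe : Tendsto (fun n => C * ‖v n - w n - z‖) atTop (nhds 0) := by
    simpa using he.const_mul C
  exact ⟨x, y, r, hx, hy,
    squeeze_zero' (.of_forall fun _ => norm_nonneg _) (hsmall.mono fun n hn => (hb n hn).1) hCe,
    squeeze_zero' (.of_forall fun _ => norm_nonneg _) (hsmall.mono fun n hn => (hb n hn).2) hCe,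
    hxy⟩
end

section
/- Let X be a real Banach space and K ⊆ B_X a compact convex subset, where B_X is the closed unit ball of X. If X is K-URED, then every nearest point map from B_X onto K, i.e. every map R : B_X → K satisfying ‖x − R(x)‖ = inf_{y ∈ K} ‖x − y‖ for all x ∈ B_X, is uniformly continuous. -/
open Filter Metric

/-- `X` is `K`-URED: uniformly rotund in every direction belonging to the linear span of `K`. -/
def KURED (X : Type*) [NormedAddCommGroup X] [NormedSpace ℝ X] (K : Set X) : Prop :=
  ∀ z ∈ Submodule.span ℝ K, UniformlyRotundInDirection X z

section

variable {X : Type*} [NormedAddCommGroup X] [NormedSpace ℝ X]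

/-- A ray starting in the closed ball of radius `r` hits the sphere of radius `r`. -/
lemma exists_norm_add_smul_eq {u z : X} {r : ℝ} (hz : z ≠ 0) (hu : ‖u‖ ≤ r) :
    ∃ s : ℝ, 0 ≤ s ∧ s ≤ 2 * r / ‖z‖ ∧ ‖u + s • z‖ = r := by
  have hz' : 0 < ‖z‖ := norm_pos_iff.mpr hz
  have hr : 0 ≤ r := (norm_nonneg u).trans hu
  have hb : 0 ≤ 2 * r / ‖z‖ := by positivity
  have hcont : ContinuousOn (fun s : ℝ => ‖u + s • z‖) (Set.Icc 0 (2 * r / ‖z‖)) := by fun_prop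
  have hfar : r ≤ ‖u + (2 * r / ‖z‖) • z‖ := by
    have h1 : ‖(2 * r / ‖z‖) • z‖ = 2 * r := by
      rw [norm_smul, Real.norm_of_nonneg hb]
      field_simp
    have h2 := norm_sub_le (u + (2 * r / ‖z‖) • z) u
    rw [add_sub_cancel_left, h1] at h2
    linarith
  obtain ⟨s, hs, hsr⟩ := intermediate_value_Icc hb hcont ⟨by simpa using hu, hfar⟩
  exact ⟨s, hs.1, hs.2, hsr⟩

/-- If the point at parameter `p + q` of a segment is compared with the point at parameter `p`,
the norm deficit at the former is at most `(p + q) / p` times the deficit at the latter. -/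
lemma norm_deficit_le {x z : X} {r p q : ℝ} (hx : ‖x‖ ≤ r) (hp : 0 < p) (hq : 0 ≤ q) :
    p * (r - ‖x + (p + q) • z‖) ≤ (p + q) * (r - ‖x + p • z‖) := by
  have h : (p + q) • (x + p • z) = q • x + p • (x + (p + q) • z) := by module
  have h1 : (p + q) * ‖x + p • z‖ ≤ q * ‖x‖ + p * ‖x + (p + q) • z‖ := by
    calc (p + q) * ‖x + p • z‖ = ‖(p + q) • (x + p • z)‖ := by
          rw [norm_smul, Real.norm_of_nonneg (by linarith)]
      _ ≤ ‖q • x‖ + ‖p • (x + (p + q) • z)‖ := h ▸ norm_add_le _ _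
      _ = _ := by
          rw [norm_smul, norm_smul, Real.norm_of_nonneg hq, Real.norm_of_nonneg hp.le]
  nlinarith [mul_le_mul_of_nonneg_left hx hq]

/-- A segment inside a closed ball extends to a chord of that ball whose midpoint deficit is
controlled by the midpoint deficit of the segment. -/
lemma exists_chord_extension {u z : X} {r : ℝ} (hz : z ≠ 0) (hu : ‖u‖ ≤ r) (huz : ‖u + z‖ ≤ r) :
    ∃ (x y : X) (c : ℝ), ‖x‖ = r ∧ ‖y‖ = r ∧ y - x = c • z ∧ 1 ≤ c ∧
      r - ‖(2 : ℝ)⁻¹ • (x + y)‖ ≤ (1 + 4 * r / ‖z‖) * (r - ‖u + (2 : ℝ)⁻¹ • z‖) := by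
  obtain ⟨s, hs0, hs, hsr⟩ := exists_norm_add_smul_eq (neg_ne_zero.mpr hz) hu
  obtain ⟨t, ht0, ht, htr⟩ := exists_norm_add_smul_eq hz huz
  rw [norm_neg] at hs
  refine ⟨u + s • -z, u + z + t • z, 1 + s + t, hsr, htr, by module, by linarith, ?_⟩
  set m := (2 : ℝ)⁻¹ • (u + s • -z + (u + z + t • z)) with hm
  have hdef : 0 ≤ r - ‖u + (2 : ℝ)⁻¹ • z‖ := by
    have h : u + (2 : ℝ)⁻¹ • z = (2 : ℝ)⁻¹ • (u + (u + z)) := by module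
    have h1 := norm_add_le u (u + z)
    rw [h, norm_smul, Real.norm_of_nonneg (by norm_num)]
    linarith
  have hmr : 0 ≤ r - ‖m‖ := by
    have h1 := norm_add_le (u + s • -z) (u + z + t • z)
    rw [hm, norm_smul, Real.norm_of_nonneg (by norm_num)]
    linarith
  have hst : 1 + s + t ≤ 1 + 4 * r / ‖z‖ := by
    have : 4 * r / ‖z‖ = 2 * r / ‖z‖ + 2 * r / ‖z‖ := by ring
    linarith
  refine le_trans ?_ (mul_le_mul_of_nonneg_right hst hdef)
  rcases le_total s t with hle | hle
  · have key := norm_deficit_le (z := z) (p := 1 / 2 + s) (q := (t - s) / 2)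
      hsr.le (by linarith) (by linarith)
    have e1 : u + s • -z + (1 / 2 + s + (t - s) / 2) • z = m := by rw [hm]; module
    have e2 : u + s • -z + (1 / 2 + s) • z = u + (2 : ℝ)⁻¹ • z := by module
    rw [e1, e2] at key
    nlinarith [mul_nonneg hs0 hmr]
  · have key := norm_deficit_le (z := -z) (p := 1 / 2 + t) (q := (s - t) / 2)
      htr.le (by linarith) (by linarith)
    have e1 : u + z + t • z + (1 / 2 + t + (s - t) / 2) • -z = m := by rw [hm]; module
    have e2 : u + z + t • z + (1 / 2 + t) • -z = u + (2 : ℝ)⁻¹ • z := by module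
    rw [e1, e2] at key
    nlinarith [mul_nonneg ht0 hmr]

/-- In a space uniformly rotund in the direction `z ≠ 0`, translates of the segment `[0, z]` lying
in balls of bounded radii cannot have midpoints asymptotically on the bounding spheres. -/
lemma UniformlyRotundInDirection.not_tendsto_midpoint_deficit {z : X}
    (h : UniformlyRotundInDirection X z) (hz : z ≠ 0) {u : ℕ → X} {r e : ℕ → ℝ} {M : ℝ}
    (hu : ∀ n, ‖u n‖ ≤ r n) (huz : ∀ n, ‖u n + z‖ ≤ r n) (hM : ∀ n, r n ≤ M)
    (he : ∀ n, r n - ‖u n + (2 : ℝ)⁻¹ • z‖ ≤ e n) : ¬ Tendsto e atTop (nhds 0) := by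
  intro he0
  have hz' : 0 < ‖z‖ := norm_pos_iff.mpr hz
  have hr : ∀ n, ‖z‖ / 2 ≤ r n := fun n => by
    have h1 := norm_sub_le (u n + z) (u n)
    rw [add_sub_cancel_left] at h1
    linarith [hu n, huz n]
  have hr0 : ∀ n, 0 < r n := fun n => (half_pos hz').trans_le (hr n)
  have hM0 : 0 < M := (hr0 0).trans_le (hM 0)
  choose x y c hx hy hc hc1 hxy using fun n => exists_chord_extension hz (hu n) (huz n)
  have hunit : ∀ n (w : X), ‖w‖ = r n → ‖(r n)⁻¹ • w‖ = 1 := fun n w hw => by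
    rw [norm_smul, hw, norm_inv, Real.norm_of_nonneg (hr0 n).le, inv_mul_cancel₀ (hr0 n).ne']
  have hdiff : ∀ n, (r n)⁻¹ • y n - (r n)⁻¹ • x n = ((r n)⁻¹ * c n) • z := fun n => by
    rw [← smul_sub, hc, smul_smul]
  have hlim := h (fun n => (r n)⁻¹ • y n) (fun n => (r n)⁻¹ • x n) (fun n => (r n)⁻¹ * c n)
    (fun n => hunit n _ (hy n)) (fun n => hunit n _ (hx n)) ?_ hdiff
  · have hge : ‖z‖ / M ≤ 0 := by
      refine ge_of_tendsto' hlim fun n => ?_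
      have hcn : (0 : ℝ) ≤ c n := zero_le_one.trans (hc1 n)
      rw [hdiff, norm_smul, Real.norm_of_nonneg (mul_nonneg (inv_pos.mpr (hr0 n)).le hcn),
        div_eq_inv_mul]
      refine mul_le_mul_of_nonneg_right ?_ hz'.le
      have h1 : M⁻¹ ≤ (r n)⁻¹ := inv_anti₀ (hr0 n) (hM n)
      have h2 := mul_le_mul_of_nonneg_left (hc1 n) (inv_pos.mpr (hr0 n)).le
      linarith
    exact absurd hge (not_le.mpr (div_pos hz' hM0))
  · set C := (‖z‖ / 2)⁻¹ * (1 + 4 * M / ‖z‖)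
    have hmid : ∀ n, ‖(2 : ℝ)⁻¹ • ((r n)⁻¹ • y n + (r n)⁻¹ • x n)‖
        = (r n)⁻¹ * ‖(2 : ℝ)⁻¹ • (x n + y n)‖ := fun n => by
      rw [← smul_add, smul_comm, norm_smul, norm_inv, Real.norm_of_nonneg (hr0 n).le,
        add_comm (y n)]
    have hlow : Tendsto (fun n => 1 - C * e n) atTop (nhds 1) := by
      simpa using tendsto_const_nhds.sub (he0.const_mul C)
    refine tendsto_of_tendsto_of_tendsto_of_le_of_le hlow tendsto_const_nhds
      (fun n => ?_) (fun n => ?_)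
    · have hdef : 0 ≤ r n - ‖u n + (2 : ℝ)⁻¹ • z‖ := by
        have h2 : u n + (2 : ℝ)⁻¹ • z = (2 : ℝ)⁻¹ • (u n + (u n + z)) := by module
        have h1 := norm_add_le (u n) (u n + z)
        rw [h2, norm_smul, Real.norm_of_nonneg (by norm_num)]
        linarith [hu n, huz n]
      have hdev : r n - ‖(2 : ℝ)⁻¹ • (x n + y n)‖ ≤ (1 + 4 * M / ‖z‖) * e n := by
        refine (hxy n).trans ?_
        have := hM n
        have := hr0 n
        gcongr
        exact he n
      have he_nonneg : 0 ≤ (1 + 4 * M / ‖z‖) * e n :=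
        mul_nonneg (by positivity) (hdef.trans (he n))
      have h1 : (r n)⁻¹ ≤ (‖z‖ / 2)⁻¹ := inv_anti₀ (half_pos hz') (hr n)
      have h2 := mul_le_mul_of_nonneg_left hdev (inv_pos.mpr (hr0 n)).le
      have h3 := mul_le_mul_of_nonneg_right h1 he_nonneg
      rw [mul_sub, inv_mul_cancel₀ (hr0 n).ne', ← hmid] at h2
      have h4 : C * e n = (‖z‖ / 2)⁻¹ * ((1 + 4 * M / ‖z‖) * e n) := mul_assoc _ _ _
      simp only
      linarith
    · have h1 := norm_add_le ((r n)⁻¹ • y n) ((r n)⁻¹ • x n)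
      rw [hunit n _ (hy n), hunit n _ (hx n)] at h1
      simp only [norm_smul]
      rw [Real.norm_of_nonneg (by norm_num)]
      linarith

end

/-- Let `X` be a real Banach space and `K ⊆ B_X` a compact convex subset.
If `X` is `K`-URED, then every nearest point map from the closed unit ball `B_X` onto `K`
is uniformly continuous. -/
theorem nearest_point_map_uniformly_continuous_of_KURED
    {X : Type*} [NormedAddCommGroup X] [NormedSpace ℝ X] [CompleteSpace X]
    (K : Set X) (hKc : IsCompact K) (hKconv : Convex ℝ K)
    (hKB : K ⊆ closedBall (0 : X) 1)
    (hured : KURED X K)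
    (R : X → X)
    (hR : ∀ x ∈ closedBall (0 : X) 1, R x ∈ K ∧ ‖x - R x‖ = infDist x K) :
    UniformContinuousOn R (closedBall (0 : X) 1) := by
  by_contra hnot
  rw [Metric.uniformContinuousOn_iff] at hnot
  push Not at hnot
  obtain ⟨ε, hε, hbad⟩ := hnot
  choose x hx x' hx' hxx' hRR using fun n : ℕ => hbad (1 / ((n : ℝ) + 1)) Nat.one_div_pos_of_nat
  have hclose : Tendsto (fun n => dist (x n) (x' n)) atTop (nhds 0) :=
    squeeze_zero (fun _ => dist_nonneg) (fun n => (hxx' n).le) tendsto_one_div_add_atTop_nhds_zero_nat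
  obtain ⟨⟨a, b⟩, ⟨ha, hb⟩, φ, hφ, hlim⟩ := (hKc.prod hKc).tendsto_subseq
    (x := fun n => (R (x n), R (x' n))) fun n => ⟨(hR _ (hx n)).1, (hR _ (hx' n)).1⟩
  have hla : Tendsto (fun n => R (x (φ n))) atTop (nhds a) := (continuous_fst.tendsto _).comp hlim
  have hlb : Tendsto (fun n => R (x' (φ n))) atTop (nhds b) := (continuous_snd.tendsto _).comp hlim
  have hab : ε ≤ dist a b := ge_of_tendsto' (hla.dist hlb) fun n => hRR (φ n)
  have hz : a - b ≠ 0 := sub_ne_zero.mpr (dist_pos.mp (hε.trans_le hab))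
  have hzK : a - b ∈ Submodule.span ℝ K :=
    sub_mem (Submodule.subset_span ha) (Submodule.subset_span hb)
  set δ : ℕ → ℝ := fun n =>
    dist (R (x (φ n))) a + dist (R (x' (φ n))) b + 2 * dist (x (φ n)) (x' (φ n)) with hδ
  have hδ0 : Tendsto δ atTop (nhds 0) := by
    have h1 := tendsto_iff_dist_tendsto_zero.mp hla
    have h2 := tendsto_iff_dist_tendsto_zero.mp hlb
    simpa using (h1.add h2).add ((hclose.comp hφ.tendsto_atTop).const_mul 2)
  obtain ⟨B, hB⟩ := hδ0.bddAbove_range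
  refine (hured _ hzK).not_tendsto_midpoint_deficit hz (u := fun n => x (φ n) - a)
    (r := fun n => infDist (x (φ n)) K + δ n) (e := δ) (M := 2 + B) ?_ ?_ ?_ ?_ hδ0
  · intro n
    have h1 := dist_triangle (x (φ n)) (R (x (φ n))) a
    have h2 := (hR _ (hx (φ n))).2
    rw [← dist_eq_norm] at h2 ⊢
    have h3 : 0 ≤ dist (R (x' (φ n))) b := dist_nonneg
    have h4 : 0 ≤ dist (x (φ n)) (x' (φ n)) := dist_nonneg
    simp only [hδ]
    linarith
  · intro n
    have h1 := dist_triangle4 (x (φ n)) (x' (φ n)) (R (x' (φ n))) b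
    have h2 := (hR _ (hx' (φ n))).2
    have h3 := infDist_le_infDist_add_dist (s := K) (x := x' (φ n)) (y := x (φ n))
    rw [dist_comm] at h3
    rw [sub_add_sub_cancel]
    rw [← dist_eq_norm] at h2 ⊢
    have h4 : 0 ≤ dist (R (x (φ n))) a := dist_nonneg
    simp only [hδ]
    linarith
  · intro n
    have h1 : infDist (x (φ n)) K ≤ dist (x (φ n)) a := infDist_le_dist_of_mem ha
    have h2 := dist_triangle_right (x (φ n)) a 0
    have h3 := mem_closedBall.mp (hx (φ n))
    have h4 := mem_closedBall.mp (hKB ha)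
    have h5 : δ n ≤ B := hB (Set.mem_range_self n)
    linarith
  · intro n
    have hmem : (2 : ℝ)⁻¹ • a + (2 : ℝ)⁻¹ • b ∈ K :=
      hKconv ha hb (by norm_num) (by norm_num) (by norm_num)
    have h1 := infDist_le_dist_of_mem (x := x (φ n)) hmem
    have h2 : x (φ n) - a + (2 : ℝ)⁻¹ • (a - b) = x (φ n) - ((2 : ℝ)⁻¹ • a + (2 : ℝ)⁻¹ • b) := by
      module
    rw [h2, ← dist_eq_norm]
    linarith
end

section
/- For every compact subset K of a real Banach space (X, ‖·‖), there exists an equivalent norm |||·||| on X (i.e. there are constants 0 < c ≤ C with c‖x‖ ≤ |||x||| ≤ C‖x‖ for all x ∈ X) such that (X, |||·|||) is K-URED, i.e. (X, |||·|||) is uniformly rotund in the direction z for every z in the linear span of K. -/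
open Filter

/-- Uniform rotundity in the direction `z` of a (candidate) norm `N` on `X`: for all
sequences `(x n)`, `(y n)` with `N (x n) = N (y n) = 1`, `N ((x n + y n)/2) → 1` and
`x n - y n = r n • z`, one has `N (x n - y n) → 0`. -/
def UniformlyRotundInDirectionWith {X : Type*} [AddCommGroup X] [Module ℝ X]
    (N : X → ℝ) (z : X) : Prop :=
  ∀ (x y : ℕ → X) (r : ℕ → ℝ),
    (∀ n, N (x n) = 1) → (∀ n, N (y n) = 1) →
    Tendsto (fun n => N ((2 : ℝ)⁻¹ • (x n + y n))) atTop (nhds 1) →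
    (∀ n, x n - y n = r n • z) →
    Tendsto (fun n => N (x n - y n)) atTop (nhds 0)

namespace EquivalentNorm

/-- The norm `x ↦ √(‖x‖ ^ 2 + ‖T x‖ ^ 2)` obtained by pulling back the `ℓ²`-sum norm along the
graph of `T`. -/
noncomputable def graphNorm {X H : Type*} [NormedAddCommGroup X] [NormedSpace ℝ X]
    [NormedAddCommGroup H] [NormedSpace ℝ H] (T : X →L[ℝ] H) (x : X) : ℝ :=
  ‖WithLp.toLp 2 (x, T x)‖

section graphNorm

variable {X H : Type*} [NormedAddCommGroup X] [NormedSpace ℝ X]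

section NormedSpace

variable [NormedAddCommGroup H] [NormedSpace ℝ H] (T : X →L[ℝ] H)

lemma graphNorm_nonneg (x : X) : 0 ≤ graphNorm T x := norm_nonneg _

lemma graphNorm_sq (x : X) : graphNorm T x ^ 2 = ‖x‖ ^ 2 + ‖T x‖ ^ 2 :=
  WithLp.prod_norm_sq_eq_of_L2 _

lemma graphNorm_add_le (x y : X) : graphNorm T (x + y) ≤ graphNorm T x + graphNorm T y := by
  simpa [graphNorm, ← WithLp.toLp_add] using
    norm_add_le (WithLp.toLp 2 (x, T x)) (WithLp.toLp 2 (y, T y))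

lemma graphNorm_smul (a : ℝ) (x : X) : graphNorm T (a • x) = |a| * graphNorm T x := by
  simpa [graphNorm, ← WithLp.toLp_smul] using norm_smul a (WithLp.toLp 2 (x, T x))

lemma norm_le_graphNorm (x : X) : ‖x‖ ≤ graphNorm T x := by
  refine le_of_sq_le_sq ?_ (graphNorm_nonneg T x)
  rw [graphNorm_sq]
  exact le_add_of_nonneg_right (sq_nonneg _)

lemma graphNorm_le (x : X) : graphNorm T x ≤ (1 + ‖T‖) * ‖x‖ := by
  refine le_of_sq_le_sq ?_ (by positivity)
  rw [graphNorm_sq]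
  have h : ‖T x‖ ^ 2 ≤ (‖T‖ * ‖x‖) ^ 2 := by gcongr; exact T.le_opNorm x
  nlinarith [mul_nonneg (norm_nonneg T) (sq_nonneg ‖x‖)]

end NormedSpace

variable [NormedAddCommGroup H] [InnerProductSpace ℝ H] (T : X →L[ℝ] H)

lemma norm_map_sub_sq_le (x y : X) :
    ‖T (x - y)‖ ^ 2 ≤ 2 * graphNorm T x ^ 2 + 2 * graphNorm T y ^ 2 -
      4 * graphNorm T ((2 : ℝ)⁻¹ • (x + y)) ^ 2 := by
  have hX : ‖x + y‖ ^ 2 ≤ 2 * ‖x‖ ^ 2 + 2 * ‖y‖ ^ 2 := by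
    nlinarith [norm_add_le x y, norm_nonneg (x + y), sq_nonneg (‖x‖ - ‖y‖)]
  have hH := parallelogram_law_with_norm ℝ (T x) (T y)
  rw [graphNorm_smul, mul_pow, sq_abs]
  simp only [graphNorm_sq, map_add, map_sub]
  linarith

/-- The graph norm of an operator into an inner product space is uniformly rotund in every
direction which the operator does not kill. -/
lemma uniformlyRotundInDirectionWith_graphNorm {z : X} (hz : T z ≠ 0) :
    UniformlyRotundInDirectionWith (graphNorm T) z := by
  intro x y r hx hy hxy hr
  have hbound (n : ℕ) : (r n) ^ 2 * ‖T z‖ ^ 2 ≤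
      4 - 4 * graphNorm T ((2 : ℝ)⁻¹ • (x n + y n)) ^ 2 := by
    have h := norm_map_sub_sq_le T (x n) (y n)
    rw [hx, hy, hr, map_smul, norm_smul, mul_pow, Real.norm_eq_abs, sq_abs] at h
    linarith
  have hlim : Tendsto (fun n ↦ (r n) ^ 2 * ‖T z‖ ^ 2) atTop (nhds 0) := by
    refine squeeze_zero (fun n ↦ by positivity) hbound ?_
    simpa using ((hxy.pow 2).const_mul 4).const_sub 4
  have hr0 : Tendsto (fun n ↦ |r n|) atTop (nhds 0) := by
    have hz' : ‖T z‖ ^ 2 ≠ 0 := by simpa using hz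
    have h := (hlim.div_const (‖T z‖ ^ 2)).sqrt
    rw [zero_div, Real.sqrt_zero] at h
    refine h.congr fun n ↦ ?_
    rw [mul_div_cancel_right₀ _ hz', Real.sqrt_sq_eq_abs]
  simpa [hr, graphNorm_smul] using hr0.mul_const (graphNorm T z)

end graphNorm

lemma uniformlyRotundInDirectionWith_zero {X : Type*} [AddCommGroup X] [Module ℝ X]
    {N : X → ℝ} (hN : N 0 = 0) : UniformlyRotundInDirectionWith N 0 := by
  intro x y r _ _ _ hr
  simp [hr, hN]

section Separable

variable {X : Type*} [NormedAddCommGroup X] [NormedSpace ℝ X]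

/-- Countably many functionals in the dual unit ball separate the points of a separable set
from zero. -/
lemma exists_seq_dual_separating {S : Set X} (hS : TopologicalSpace.IsSeparable S) :
    ∃ f : ℕ → X →L[ℝ] ℝ, (∀ n, ‖f n‖ ≤ 1) ∧ ∀ z ∈ S, z ≠ 0 → ∃ n, f n z ≠ 0 := by
  obtain ⟨c, hc, hSc⟩ := hS
  obtain rfl | hne := c.eq_empty_or_nonempty
  · exact ⟨0, by simp, fun z hz ↦ by simpa using hSc hz⟩
  obtain ⟨u, rfl⟩ := hc.exists_eq_range hne
  choose f hf hfu using fun n ↦ exists_dual_vector'' ℝ (u n)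
  refine ⟨f, hf, fun z hz hz0 ↦ ?_⟩
  obtain ⟨_, ⟨n, rfl⟩, hn⟩ :=
    Metric.mem_closure_iff.1 (hSc hz) (‖z‖ / 2) (half_pos (norm_pos_iff.2 hz0))
  refine ⟨n, fun h0 ↦ ?_⟩
  have h1 : ‖u n‖ ≤ ‖z - u n‖ := by
    have h := (f n).le_of_opNorm_le (hf n) (z - u n)
    simpa [h0, hfu n] using h
  rw [dist_eq_norm] at hn
  linarith [norm_le_norm_add_norm_sub' z (u n)]

/-- A bounded sequence of functionals induces a bounded operator into `ℓ²` with the same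
common kernel. -/
lemma exists_clm_lp_two {f : ℕ → X →L[ℝ] ℝ} (hf : ∀ n, ‖f n‖ ≤ 1) :
    ∃ T : X →L[ℝ] lp (fun _ : ℕ ↦ ℝ) 2, ∀ x n, T x n = (1 / 2) ^ n * f n x := by
  have hgeom := summable_geometric_of_lt_one (r := (1 / 4 : ℝ)) (by norm_num) (by norm_num)
  have hle (x : X) (n : ℕ) :
      ‖(1 / 2) ^ n * f n x‖ ^ (2 : ENNReal).toReal ≤ (1 / 4) ^ n * ‖x‖ ^ 2 := by
    have h := (f n).le_of_opNorm_le (hf n) x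
    rw [one_mul] at h
    have h4 : (1 / 4 : ℝ) ^ n = ((1 / 2) ^ n) ^ 2 := by
      rw [← pow_mul, mul_comm, pow_mul]; norm_num
    rw [ENNReal.toReal_ofNat, Real.rpow_two, norm_mul, mul_pow, h4, norm_pow, Real.norm_eq_abs,
      abs_of_pos (by norm_num : (0 : ℝ) < 1 / 2)]
    gcongr
  have hsum (x : X) : Summable fun n ↦ ‖(1 / 2) ^ n * f n x‖ ^ (2 : ENNReal).toReal :=
    (hgeom.mul_right (‖x‖ ^ 2)).of_nonneg_of_le (fun n ↦ by positivity) (hle x)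
  let L : X →ₗ[ℝ] lp (fun _ : ℕ ↦ ℝ) 2 :=
    { toFun := fun x ↦ ⟨fun n ↦ (1 / 2) ^ n * f n x, memℓp_gen (hsum x)⟩
      map_add' := fun x y ↦ Subtype.ext <| funext fun n ↦ by
        simp only [map_add, mul_add]; rfl
      map_smul' := fun a x ↦ by ext n; simp [mul_left_comm] }
  refine ⟨L.mkContinuous 2 fun x ↦ ?_, fun x n ↦ rfl⟩
  refine lp.norm_le_of_tsum_le (by norm_num) (by positivity) ?_
  refine ((hsum x).tsum_le_tsum (hle x) (hgeom.mul_right _)).trans ?_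
  rw [tsum_mul_right, tsum_geometric_of_lt_one (by norm_num) (by norm_num),
    ENNReal.toReal_ofNat, Real.rpow_two]
  nlinarith [sq_nonneg ‖x‖]

end Separable

end EquivalentNorm

open EquivalentNorm

/-- For every compact subset `K` of a real Banach space `X` there is an
equivalent norm `N` on `X` which is uniformly rotund in the direction `z` for every `z` in
the linear span of `K` (i.e. `(X, N)` is `K`-URED). -/
theorem exists_equivalent_KURED_norm
    {X : Type*} [NormedAddCommGroup X] [NormedSpace ℝ X] [CompleteSpace X]
    (K : Set X) (hK : IsCompact K) :
    ∃ N : X → ℝ,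
      (∀ x y : X, N (x + y) ≤ N x + N y) ∧
      (∀ (a : ℝ) (x : X), N (a • x) = |a| * N x) ∧
      (∃ c C : ℝ, 0 < c ∧ c ≤ C ∧ ∀ x : X, c * ‖x‖ ≤ N x ∧ N x ≤ C * ‖x‖) ∧
      ∀ z ∈ Submodule.span ℝ K, UniformlyRotundInDirectionWith N z := by
  have hsep : TopologicalSpace.IsSeparable (Submodule.span ℝ K : Set X) := hK.isSeparable.span
  obtain ⟨f, hf, hfz⟩ := exists_seq_dual_separating hsep
  obtain ⟨T, hT⟩ := exists_clm_lp_two hf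
  refine ⟨graphNorm T, graphNorm_add_le T, graphNorm_smul T,
    ⟨1, 1 + ‖T‖, one_pos, by simp, fun x ↦ ⟨by simpa using norm_le_graphNorm T x,
      graphNorm_le T x⟩⟩, fun z hz ↦ ?_⟩
  obtain rfl | hz0 := eq_or_ne z 0
  · exact uniformlyRotundInDirectionWith_zero (by simpa using graphNorm_smul T 0 0)
  refine uniformlyRotundInDirectionWith_graphNorm T fun h0 ↦ ?_
  obtain ⟨n, hn⟩ := hfz z hz hz0
  have h := hT z n
  simp [h0, hn] at h
end

section
/- For every compact convex subset K of a real Banach space X there exists a uniformly continuous retraction from X onto K: a uniformly continuous map R : X → K with R(k) = k for every k ∈ K. -/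
open scoped InnerProductSpace

/-- A compact subset of a real normed space is mapped injectively into a Hilbert space by some
continuous linear map defined on the whole space. -/
theorem IsCompact.exists_continuousLinearMap_injOn_lp
    {X : Type*} [NormedAddCommGroup X] [NormedSpace ℝ X] {K : Set X} (hK : IsCompact K) :
    ∃ T : X →L[ℝ] lp (fun _ : ℕ => ℝ) 2, Set.InjOn T K := by
  obtain rfl | hne := K.eq_empty_or_nonempty
  · exact ⟨0, Set.injOn_empty _⟩
  have hD : IsCompact ((fun p : X × X => p.1 - p.2) '' (K ×ˢ K)) :=
    (hK.prod hK).image (by fun_prop)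
  set D := (fun p : X × X => p.1 - p.2) '' (K ×ˢ K)
  have : Nonempty D := ((hne.prod hne).image _).to_subtype
  have : TopologicalSpace.SeparableSpace D := hD.isSeparable.separableSpace
  let d : ℕ → D := TopologicalSpace.denseSeq D
  have hd : DenseRange d := TopologicalSpace.denseRange_denseSeq D
  choose f hf1 hf2 using fun n => exists_dual_vector'' ℝ (d n : X)
  let e : ℕ → lp (fun _ : ℕ => ℝ) 2 := fun n => lp.single 2 n (1 : ℝ)
  have he : ∀ n, ‖e n‖ = 1 := fun n => by
    simp [e, lp.norm_single]
  let S : ℕ → (X →L[ℝ] lp (fun _ : ℕ => ℝ) 2) :=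
    fun n => ((1 / 2 : ℝ) ^ n) • (f n).smulRight (e n)
  have hS : Summable S := by
    refine Summable.of_norm_bounded summable_geometric_two fun n => ?_
    rw [norm_smul, ContinuousLinearMap.norm_smulRight_apply, he, mul_one, Real.norm_of_nonneg
      (by positivity)]
    exact mul_le_of_le_one_right (by positivity) (hf1 n)
  have hcoord : ∀ z m, ⟪e m, (∑' n, S n) z⟫_ℝ = (1 / 2 : ℝ) ^ m * f m z := fun z m => by
    have h1 : HasSum (fun n => S n z) ((∑' n, S n) z) :=
      hS.hasSum.mapL (ContinuousLinearMap.apply ℝ _ z)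
    have h2 : HasSum (fun n => ⟪e m, S n z⟫_ℝ) ⟪e m, (∑' n, S n) z⟫_ℝ :=
      h1.mapL (innerSL ℝ (e m))
    refine h2.unique ?_
    convert hasSum_single (f := fun n => ⟪e m, S n z⟫_ℝ) m fun n hn => ?_ using 1
    · simp [S, e, lp.inner_single_left, lp.single_apply]
    · simp [S, e, lp.inner_single_left, lp.single_apply, hn.symm]
  refine ⟨∑' n, S n, fun x hx y hy hxy => ?_⟩
  have hzero : ∀ m, f m (x - y) = 0 := fun m => by
    have h := hcoord (x - y) m
    rw [map_sub, hxy, sub_self, inner_zero_right] at h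
    simpa using h.symm
  have hclosed : IsClosed {u : D | ‖(u : X)‖ ≤ ‖(u : X) - (x - y)‖} :=
    isClosed_le (by fun_prop) (by fun_prop)
  have hle : ∀ u : D, ‖(u : X)‖ ≤ ‖(u : X) - (x - y)‖ := fun u => by
    refine hd.induction_on (p := fun u : D => ‖(u : X)‖ ≤ ‖(u : X) - (x - y)‖) u hclosed fun n => ?_
    calc ‖(d n : X)‖ = f n ((d n : X) - (x - y)) := by
          rw [map_sub, hzero, sub_zero, hf2]; rfl
      _ ≤ ‖f n ((d n : X) - (x - y))‖ := Real.le_norm_self _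
      _ ≤ ‖(d n : X) - (x - y)‖ := (f n).le_of_opNorm_le_of_le (hf1 n) le_rfl |>.trans_eq (one_mul _)
  have h := hle ⟨x - y, (x, y), ⟨hx, hy⟩, rfl⟩
  simpa [sub_eq_zero] using h

/-- The metric projection onto a nonempty complete convex subset of a real inner product space is
a `1`-Lipschitz retraction. -/
theorem Convex.exists_lipschitzWith_one_retraction
    {H : Type*} [NormedAddCommGroup H] [InnerProductSpace ℝ H] {C : Set H}
    (hne : C.Nonempty) (hcomp : IsComplete C) (hconv : Convex ℝ C) :
    ∃ P : H → H, LipschitzWith 1 P ∧ (∀ x, P x ∈ C) ∧ ∀ c ∈ C, P c = c := by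
  choose P hP hmin using exists_norm_eq_iInf_of_complete_convex hne hcomp hconv
  have hinner : ∀ u, ∀ w ∈ C, ⟪u - P u, w - P u⟫_ℝ ≤ 0 := fun u =>
    (norm_eq_iInf_iff_real_inner_le_zero hconv (hP u)).1 (hmin u)
  refine ⟨P, LipschitzWith.of_dist_le_mul fun x y => ?_, hP, fun c hc => ?_⟩
  · rw [NNReal.coe_one, one_mul, dist_eq_norm, dist_eq_norm]
    have hsq : ‖P x - P y‖ * ‖P x - P y‖ ≤ ‖x - y‖ * ‖P x - P y‖ := by
      have h1 := hinner x (P y) (hP y)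
      have h2 := hinner y (P x) (hP x)
      have h3 := real_inner_le_norm (x - y) (P x - P y)
      rw [← real_inner_self_eq_norm_mul_norm]
      simp only [inner_sub_left, inner_sub_right] at *
      linarith
    by_contra! hlt
    exact hsq.not_gt (mul_lt_mul_of_pos_right hlt ((norm_nonneg _).trans_lt hlt))
  · have h := hinner c c hc
    rw [real_inner_self_nonpos, sub_eq_zero] at h
    exact h.symm

/-- For every (nonempty) compact convex subset `K` of a real Banach space
`X` there exists a uniformly continuous retraction from `X` onto `K`. -/
theorem exists_uniformly_continuous_retraction_onto_convex_compact
    {X : Type*} [NormedAddCommGroup X] [NormedSpace ℝ X] [CompleteSpace X]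
    (K : Set X) (hKne : K.Nonempty) (hKc : IsCompact K) (hKconv : Convex ℝ K) :
    ∃ R : X → X, UniformContinuous R ∧ (∀ x, R x ∈ K) ∧ ∀ k ∈ K, R k = k := by
  obtain ⟨T, hT⟩ := hKc.exists_continuousLinearMap_injOn_lp
  obtain ⟨P, hPlip, hPmem, hPfix⟩ := Convex.exists_lipschitzWith_one_retraction
    (hKne.image T) (hKc.image T.continuous).isComplete (hKconv.linear_image T.toLinearMap)
  have : CompactSpace K := isCompact_iff_compactSpace.1 hKc
  have : CompactSpace (T '' K) := isCompact_iff_compactSpace.1 (hKc.image T.continuous)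
  let E : K ≃ T '' K := Equiv.Set.imageOfInjOn T K hT
  have hE : Continuous E := (T.continuous.comp continuous_subtype_val).subtype_mk _
  have hEsymm : UniformContinuous E.symm :=
    CompactSpace.uniformContinuous_of_continuous hE.homeoOfEquivCompactToT2.symm.continuous
  refine ⟨fun x => E.symm ⟨P (T x), hPmem (T x)⟩, ?_, fun x => Subtype.coe_prop _, fun k hk => ?_⟩
  · exact uniformContinuous_subtype_val.comp <| hEsymm.comp <|
      (hPlip.uniformContinuous.comp T.uniformContinuous).subtype_mk _
  · have h : (⟨P (T k), hPmem (T k)⟩ : T '' K) = E ⟨k, hk⟩ :=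
      Subtype.ext (hPfix _ (Set.mem_image_of_mem T hk))
    simp only [h, Equiv.symm_apply_apply]
end
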